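/- Let p ∈ 𝒜 be non-negative and non-decreasing in time t for every fixed x, let u be a bounded weak solution of the linear auxiliary problem with precipitation function p, and write v(η, s) = u(ηs, s²) for η ≥ 0, s > 0. Then for every d > 0 and every γ ≥ 0: (a) there exists ω ∈ (0,1) such that for every (η, s) with v(η, s) − Φ_γ(η) ≥ d, one has min over s' ∈ [ωs, s] of (max over η' ≥ 0 of (v(η', s') − Φ_γ(η'))) ≥ d/2; and (b) there exists ω ∈ (1, ∞) such that for every (η, s) with v(η, s) − Φ_γ(η) ≤ −d, one has max over s' ∈ [s, ωs] of (min over η' ≥ 0 of (v(η', s') − Φ_γ(η'))) ≤ −d/2. -/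

import Mathlib

open MeasureTheory Filter Set

noncomputable section

/-- The precipitation-free self-similar solution `ψ(x,t)`. -/
def psi (α β x t : ℝ) : ℝ :=
  if 0 < t then
    (α * β / 2) * Real.exp (α ^ 2 / 4) *
      ∫ ζ in Set.Ioi (max (|x| / Real.sqrt t) α), Real.exp (-ζ ^ 2 / 4)
  else 0

/-- The profile `Ψ(η)` in similarity coordinates. -/
def PsiP (α β η : ℝ) : ℝ :=
  (α * β / 2) * Real.exp (α ^ 2 / 4) * ∫ ζ in Set.Ioi (max η α), Real.exp (-ζ ^ 2 / 4)

/-- Regularity of a weak solution: `w` is the spatial derivative of `u - ψ`;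
both are continuous on `ℝ × [0,∞)` and bounded on `ℝ × [0,T]` for every `T > 0`. -/
def AuxReg (α β : ℝ) (u w : ℝ → ℝ → ℝ) : Prop :=
  (∀ t ∈ Set.Ici (0:ℝ), ∀ x : ℝ, HasDerivAt (fun y => u y t - psi α β y t) (w x t) x) ∧
  ContinuousOn (fun q : ℝ × ℝ => u q.1 q.2 - psi α β q.1 q.2) (Set.univ ×ˢ Set.Ici 0) ∧
  ContinuousOn (fun q : ℝ × ℝ => w q.1 q.2) (Set.univ ×ˢ Set.Ici 0) ∧
  ∀ T > (0:ℝ), ∃ C : ℝ, ∀ x : ℝ, ∀ t ∈ Set.Icc (0:ℝ) T,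
    |u x t - psi α β x t| ≤ C ∧ |w x t| ≤ C

/-- A test function of class `C^{1,1}(ℝ × [0,T])`, vanishing for large `|x|` and at `t = T`,
together with its partial derivatives `φt`, `φx`. -/
def IsTestFun (T : ℝ) (φ φt φx : ℝ → ℝ → ℝ) : Prop :=
  (∀ x : ℝ, ∀ t ∈ Set.Icc (0:ℝ) T,
    HasDerivWithinAt (fun s => φ x s) (φt x t) (Set.Icc 0 T) t) ∧
  (∀ x : ℝ, ∀ t ∈ Set.Icc (0:ℝ) T, HasDerivAt (fun y => φ y t) (φx x t) x) ∧
  ContinuousOn (fun q : ℝ × ℝ => φ q.1 q.2) (Set.univ ×ˢ Set.Icc 0 T) ∧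
  ContinuousOn (fun q : ℝ × ℝ => φt q.1 q.2) (Set.univ ×ˢ Set.Icc 0 T) ∧
  ContinuousOn (fun q : ℝ × ℝ => φx q.1 q.2) (Set.univ ×ˢ Set.Icc 0 T) ∧
  (∃ R : ℝ, ∀ x : ℝ, ∀ t ∈ Set.Icc (0:ℝ) T, R ≤ |x| → φ x t = 0) ∧
  (∀ x : ℝ, φ x T = 0)

/-- The weak form of the equation, relative to a given precipitation function `p` and
the spatial derivative `w` of `u - ψ`. -/
def WeakForm (α β : ℝ) (u p w : ℝ → ℝ → ℝ) : Prop :=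
  ∀ T > (0:ℝ), ∀ φ φt φx : ℝ → ℝ → ℝ, IsTestFun T φ φt φx →
    (∫ t in Set.Ioc (0:ℝ) T, ∫ x : ℝ, φt x t * (u x t - psi α β x t))
      = ∫ t in Set.Ioc (0:ℝ) T, ∫ x : ℝ, (φx x t * w x t + p x t * u x t * φ x t)

/-- A weak solution of the linear auxiliary problem with given precipitation function `p`. -/
def IsAuxSolution (α β : ℝ) (p u : ℝ → ℝ → ℝ) : Prop :=
  (∀ x t : ℝ, u (-x) t = u x t) ∧
  ∃ w : ℝ → ℝ → ℝ, AuxReg α β u w ∧ WeakForm α β u p w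

/-- A weak solution `(u, p)` of the HHMO model. -/
def IsWeakSolution (α β ustar : ℝ) (u p : ℝ → ℝ → ℝ) : Prop :=
  (∀ x t : ℝ, u (-x) t = u x t) ∧
  (∀ x t : ℝ, p (-x) t = p x t) ∧
  Measurable (fun q : ℝ × ℝ => p q.1 q.2) ∧
  (∀ x : ℝ, ∀ t ∈ Set.Ici (0:ℝ),
    (sSup ((fun s => u x s) '' Set.Icc 0 t) < ustar → p x t = 0) ∧
    (sSup ((fun s => u x s) '' Set.Icc 0 t) = ustar → p x t ∈ Set.Icc (0:ℝ) 1) ∧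
    (ustar < sSup ((fun s => u x s) '' Set.Icc 0 t) → p x t = 1)) ∧
  (∀ x : ℝ, MonotoneOn (fun t => p x t) (Set.Ici (0:ℝ))) ∧
  ∃ w : ℝ → ℝ → ℝ, AuxReg α β u w ∧ WeakForm α β u p w

/-- Condition (P): the precipitation function depends only on `x` beyond the parabola
`t = x²/α²`. -/
def CondP (α : ℝ) (p : ℝ → ℝ → ℝ) (pstar : ℝ → ℝ) : Prop :=
  Measurable pstar ∧
  ∀ᵐ x ∂(volume.restrict (Set.Ioi (0:ℝ))), ∀ t : ℝ, x ^ 2 / α ^ 2 < t → p x t = pstar x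

/-- The admissible class `𝒜` of precipitation functions. -/
def IsAdmissible (p : ℝ → ℝ → ℝ) : Prop :=
  (∀ x t : ℝ, p (-x) t = p x t) ∧
  MeasureTheory.LocallyIntegrableOn (fun q : ℝ × ℝ => p q.1 q.2) (Set.Ioi 0 ×ˢ Set.Ici 0) ∧
  ∀ T > (0:ℝ), ∃ R : ℝ, ∀ x ≥ R, ∀ t ∈ Set.Icc (0:ℝ) T, p x t = 0

/-- `u` converges uniformly, in parabolic similarity coordinates, to the profile `Φ`. -/
def ConvUnif (u : ℝ → ℝ → ℝ) (Φ : ℝ → ℝ) : Prop :=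
  ∀ ε > (0:ℝ), ∃ T : ℝ, ∀ t ≥ T, ∀ η ≥ (0:ℝ), |u (η * Real.sqrt t) t - Φ η| < ε

/-- The error function. -/
def erf (x : ℝ) : ℝ := (2 / Real.sqrt Real.pi) * ∫ s in (0:ℝ)..x, Real.exp (-s ^ 2)

/-- The complementary error function. -/
def erfc (x : ℝ) : ℝ := (2 / Real.sqrt Real.pi) * ∫ s in Set.Ioi x, Real.exp (-s ^ 2)

/-- Kummer's confluent hypergeometric function `M(a,b,z)` (real arguments). -/
def kummerM (a b z : ℝ) : ℝ :=
  ∑' n : ℕ, (Polynomial.eval a (ascPochhammer ℝ n) / Polynomial.eval b (ascPochhammer ℝ n))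
    * z ^ n / (n.factorial : ℝ)

/-- `κ = (1 + √(4γ+1))/2`, the positive root of `κ(κ-1) = γ`. -/
def kappaOf (γ : ℝ) : ℝ := (1 + Real.sqrt (4 * γ + 1)) / 2

/-- The value `u*_γ` determined by the derivative matching condition. -/
def ustarGamma (α β γ : ℝ) : ℝ :=
  (α * β / 2) *
    (kappaOf γ * kummerM (kappaOf γ / 2 + 1) (kappaOf γ + 1 / 2) (-α ^ 2 / 4) /
        (α * kummerM (kappaOf γ / 2) (kappaOf γ + 1 / 2) (-α ^ 2 / 4)) +
      Real.exp (-α ^ 2 / 4) / (Real.sqrt Real.pi * erfc (α / 2)))⁻¹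

/-- The self-similar profile `Φ_γ`. -/
def Phi (α β γ η : ℝ) : ℝ :=
  if η < α then
    ustarGamma α β γ * η ^ kappaOf γ *
      kummerM (kappaOf γ / 2) (kappaOf γ + 1 / 2) (-η ^ 2 / 4) /
      (α ^ kappaOf γ * kummerM (kappaOf γ / 2) (kappaOf γ + 1 / 2) (-α ^ 2 / 4))
  else ustarGamma α β γ * erfc (η / 2) / erfc (α / 2)

theorem ae_deriv_intervalIntegral {f : ℝ → ℝ} {a b : ℝ} (hab : a ≤ b)
    (hf : IntervalIntegrable f volume a b) {c : ℝ} (hc : c ∈ Icc a b) :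
    ∀ᵐ t, t ∈ uIoc a b → deriv (fun s => ∫ r in c..s, f r) t = f t := by
  filter_upwards [hf.ae_hasDerivAt_integral] with t ht htm
  exact (ht (uIoc_subset_uIcc htm) c (by rwa [uIcc_of_le hab])).deriv

/-- A continuous function whose weak time derivative is `-F`, with vanishing initial value,
is minus the primitive of `F`. -/
theorem eq_neg_primitive_of_weak {T : ℝ} (hT : 0 < T) {Z F : ℝ → ℝ}
    (hZ : ContinuousOn Z (Icc 0 T)) (hF : IntegrableOn F (Ioc 0 T))
    (hweak : ∀ θ θ' : ℝ → ℝ, (∀ t, HasDerivAt θ (θ' t) t) → Continuous θ' → θ T = 0 →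
      ∫ t in Ioc 0 T, θ' t * Z t = ∫ t in Ioc 0 T, θ t * F t) :
    ∀ t ∈ Icc 0 T, Z t = -∫ s in (0:ℝ)..t, F s := by
  have hFi : IntervalIntegrable F volume 0 T :=
    (intervalIntegrable_iff_integrableOn_Ioc_of_le hT.le).2 hF
  set P : ℝ → ℝ := fun t => ∫ s in (0:ℝ)..t, F s with hP
  have hPac : AbsolutelyContinuousOnInterval P 0 T :=
    hFi.absolutelyContinuousOnInterval_intervalIntegral (by simp)
  have hPc : ContinuousOn P (Icc 0 T) := by
    have := hPac.continuousOn
    rwa [uIcc_of_le hT.le] at this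
  set η : ℝ → ℝ := IccExtend hT.le (domRestrict (Icc 0 T) (fun t => Z t + P t)) with hη
  have hηc : Continuous η := (continuousOn_iff_continuous_domRestrict.1 (hZ.add hPc)).Icc_extend'
  have hηe : ∀ t ∈ Icc 0 T, η t = Z t + P t := fun t ht => by
    rw [hη, IccExtend_of_mem _ _ ht]; rfl
  set θ : ℝ → ℝ := fun t => ∫ s in T..t, η s with hθ
  have hθd : ∀ t, HasDerivAt θ (η t) t := fun t =>
    intervalIntegral.integral_hasDerivAt_right (hηc.intervalIntegrable _ _)
      (hηc.stronglyMeasurableAtFilter _ _) hηc.continuousAt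
  have hθT : θ T = 0 := by simp [hθ]
  have hθac : AbsolutelyContinuousOnInterval θ 0 T :=
    (hηc.intervalIntegrable 0 T).absolutelyContinuousOnInterval_intervalIntegral (by simp)
  have h1 := hweak θ η hθd hηc hθT
  have h2 := hPac.integral_mul_deriv_eq_deriv_mul hθac
  have hdP := ae_deriv_intervalIntegral hT.le hFi (c := 0) (by simp [hT.le])
  have h3 : ∫ t in (0:ℝ)..T, P t * deriv θ t = ∫ t in (0:ℝ)..T, η t * P t := by
    congr 1; ext t; rw [(hθd t).deriv]; ring
  have h4 : ∫ t in (0:ℝ)..T, deriv P t * θ t = ∫ t in (0:ℝ)..T, θ t * F t := by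
    apply intervalIntegral.integral_congr_ae
    filter_upwards [hdP] with t ht htm
    rw [ht htm]; ring
  have hP0 : P 0 = 0 := by simp [hP]
  rw [h3, h4, hθT, hP0] at h2
  rw [← intervalIntegral.integral_of_le hT.le, ← intervalIntegral.integral_of_le hT.le] at h1
  have hηZ : IntervalIntegrable (fun t => η t * Z t) volume 0 T :=
    ContinuousOn.intervalIntegrable (by
      rw [uIcc_of_le hT.le]; exact hηc.continuousOn.mul hZ)
  have hηP : IntervalIntegrable (fun t => η t * P t) volume 0 T :=
    ContinuousOn.intervalIntegrable (by
      rw [uIcc_of_le hT.le]; exact hηc.continuousOn.mul hPc)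
  have h5 : ∫ t in (0:ℝ)..T, η t ^ 2 = 0 := by
    have : ∫ t in (0:ℝ)..T, η t ^ 2 = ∫ t in (0:ℝ)..T, (η t * Z t + η t * P t) := by
      apply intervalIntegral.integral_congr
      intro t ht
      rw [uIcc_of_le hT.le] at ht
      simp only [hηe t ht]; ring
    rw [this, intervalIntegral.integral_add hηZ hηP]
    linarith
  intro t ht
  have h6 : η t = 0 := by
    by_contra hne
    have := intervalIntegral.integral_pos (f := fun t => η t ^ 2) hT (hηc.pow 2).continuousOn
      (fun _ _ => sq_nonneg _) ⟨t, ht, by positivity⟩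
    linarith
  have := hηe t ht
  simp only [hP] at this
  linarith

/-- A function which increases by at most `0` on all short subintervals is nonincreasing. -/
theorem le_of_locally_le {f : ℝ → ℝ} {s t δ : ℝ} (hst : s ≤ t) (hδ : 0 < δ)
    (h : ∀ a b, s ≤ a → a ≤ b → b ≤ t → b - a < δ → f b ≤ f a) : f t ≤ f s := by
  obtain ⟨n, hn⟩ := exists_nat_gt ((t - s) / δ)
  have hn0 : (0:ℝ) < n := lt_of_le_of_lt (div_nonneg (by linarith) hδ.le) hn
  set e := (t - s) / n with he
  have he0 : 0 ≤ e := div_nonneg (by linarith) hn0.le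
  have heδ : e < δ := by
    rw [he, div_lt_iff₀ hn0]; rw [div_lt_iff₀ hδ] at hn; linarith
  have hne : n * e = t - s := by rw [he]; field_simp
  have key : ∀ k : ℕ, k ≤ n → f (s + k * e) ≤ f s := by
    intro k
    induction k with
    | zero => intro _; simp
    | succ k ih =>
      intro hk
      refine le_trans (h _ _ ?_ ?_ ?_ ?_) (ih (by omega))
      · have : 0 ≤ (k:ℝ) * e := by positivity
        linarith
      · push_cast; linarith
      · have : ((k + 1 : ℕ) : ℝ) * e ≤ n * e := by gcongr
        linarith
      · push_cast; linarith
  have := key n le_rfl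
  rwa [hne, add_sub_cancel] at this

/-- The closed symmetric annulus `δ ≤ |x| ≤ R` on the line. -/
def annulus (δ R : ℝ) : Set ℝ := {x | δ ≤ |x| ∧ |x| ≤ R}

theorem isCompact_annulus (δ R : ℝ) : IsCompact (annulus δ R) := by
  have h : annulus δ R = Icc (-R) R ∩ {x | δ ≤ |x|} := by
    ext x; simp [annulus, abs_le, and_comm]
  rw [h]
  exact isCompact_Icc.inter_right (isClosed_le continuous_const continuous_abs)

/-- Bounded subsolutions `y` of `y_t = y_xx - g` on `ℝ × [0,T]` with spatial derivative `q`, a source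
`g` that is locally integrable away from `x = 0` and nonnegative where `y > 0`, and a Neumann
condition at `x = 0`. -/
structure IsHeatSubsolution (T : ℝ) (y q g : ℝ → ℝ → ℝ) : Prop where
  hasDerivAt : ∀ t ∈ Icc 0 T, ∀ x, HasDerivAt (fun ξ => y ξ t) (q x t) x
  cont : ContinuousOn (fun z : ℝ × ℝ => y z.1 z.2) (univ ×ˢ Icc 0 T)
  cont_deriv : ContinuousOn (fun z : ℝ × ℝ => q z.1 z.2) (univ ×ˢ Icc 0 T)
  bound : ∃ C, ∀ x, ∀ t ∈ Icc 0 T, |y x t| ≤ C ∧ |q x t| ≤ C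
  neumann : ∀ t ∈ Icc 0 T, 0 < y 0 t → q 0 t = 0
  source_integrable : ∀ δ > 0, ∀ R,
    IntegrableOn (fun z : ℝ × ℝ => g z.1 z.2) (annulus δ R ×ˢ Icc 0 T)
  source_nonneg : ∀ x, ∀ t ∈ Icc 0 T, 0 < y x t → 0 ≤ g x t
  weak : ∀ δ > 0, ∀ R, ∀ χ χ' : ℝ → ℝ, (∀ x, HasDerivAt χ (χ' x) x) → Continuous χ' →
    (∀ x, 0 ≤ χ x) → (∀ x, x ∉ annulus δ R → χ x = 0) →
    ∀ a b, 0 ≤ a → a ≤ b → b ≤ T →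
      ∫ x in annulus δ R, χ x * (y x b - y x a) ≤
        -∫ t in a..b, ∫ x in annulus δ R, (χ' x * q x t + χ x * g x t)

theorem hasDerivAt_max_zero_pow (n : ℕ) (r : ℝ) :
    HasDerivAt (fun s : ℝ => max s 0 ^ (n + 2)) ((n + 2) * max r 0 ^ (n + 1)) r := by
  rcases lt_trichotomy r 0 with h | h | h
  · have : (fun s : ℝ => max s 0 ^ (n + 2)) =ᶠ[nhds r] fun _ => 0 := by
      filter_upwards [Iio_mem_nhds h] with s hs
      rw [max_eq_right (le_of_lt hs)]; simp
    rw [max_eq_right h.le]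
    simpa using (hasDerivAt_const r (0:ℝ)).congr_of_eventuallyEq this
  · subst h
    simp only [max_self, ne_eq, Nat.add_eq_zero_iff, one_ne_zero, and_false, not_false_eq_true,
      zero_pow, mul_zero]
    rw [hasDerivAt_iff_isLittleO]
    simp only [sub_zero, max_self, smul_zero]
    have h1 : (fun s : ℝ => max s 0 ^ (n + 2) - 0 ^ (n + 2)) =O[nhds 0] fun s => s ^ (n + 2) := by
      refine Asymptotics.IsBigO.of_bound 1 (Eventually.of_forall fun s => ?_)
      rw [zero_pow (by omega), sub_zero, norm_pow, norm_pow, one_mul, Real.norm_eq_abs,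
        Real.norm_eq_abs]
      refine pow_le_pow_left₀ (abs_nonneg _) ?_ _
      rw [abs_of_nonneg (le_max_right s 0)]
      exact max_le (le_abs_self s) (abs_nonneg s)
    have h2 : (fun s : ℝ => s ^ (n + 2)) =o[nhds 0] fun s : ℝ => s := by
      simpa using Asymptotics.isLittleO_pow_pow (𝕜 := ℝ) (m := 1) (n := n + 2) (by omega)
    exact h1.trans_isLittleO h2
  · have : (fun s : ℝ => max s 0 ^ (n + 2)) =ᶠ[nhds r] fun s => s ^ (n + 2) := by
      filter_upwards [Ioi_mem_nhds h] with s hs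
      rw [max_eq_left (le_of_lt hs)]
    rw [max_eq_left h.le]
    refine ((hasDerivAt_pow (n + 2) r).congr_of_eventuallyEq this).congr_deriv ?_
    push_cast
    rfl

theorem max_zero_pow_three_sub_le (a b : ℝ) :
    max b 0 ^ 3 - max a 0 ^ 3 ≤ 3 * max b 0 ^ 2 * (b - a) := by
  rcases le_total b 0 with hb | hb <;> rcases le_total a 0 with ha | ha
  · simp [max_eq_right hb, max_eq_right ha]
  · simp only [max_eq_right hb, max_eq_left ha]; norm_num; positivity
  · simp only [max_eq_left hb, max_eq_right ha]
    nlinarith [mul_nonneg (sq_nonneg b) (neg_nonneg.2 ha), pow_nonneg hb 3]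
  · simp only [max_eq_left hb, max_eq_left ha]
    nlinarith [mul_nonneg (add_nonneg (mul_nonneg zero_le_two hb) ha) (sq_nonneg (b - a))]

theorem ContinuousOn.exists_forall_abs_sub_le {K : Set ℝ} (hK : IsCompact K) {s t : ℝ}
    {f : ℝ × ℝ → ℝ} (hf : ContinuousOn f (K ×ˢ Icc s t)) {ε : ℝ} (hε : 0 < ε) :
    ∃ δ > 0, ∀ x ∈ K, ∀ a ∈ Icc s t, ∀ b ∈ Icc s t, |a - b| < δ →
      |f (x, a) - f (x, b)| ≤ ε := by
  have := (hK.prod isCompact_Icc).uniformContinuousOn_of_continuous hf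
  rw [Metric.uniformContinuousOn_iff] at this
  obtain ⟨δ, hδ, h⟩ := this ε hε
  refine ⟨δ, hδ, fun x hx a ha b hb hab => ?_⟩
  have := h (x, a) ⟨hx, ha⟩ (x, b) ⟨hx, hb⟩ (by
    rw [Prod.dist_eq]; simp [Real.dist_eq, hab])
  rw [Real.dist_eq] at this
  exact this.le

theorem integrableOn_prod_Ioc {K : Set ℝ} {f : ℝ × ℝ → ℝ} {a b : ℝ}
    (hf : IntegrableOn f (K ×ˢ Icc a b)) :
    Integrable f ((volume.restrict K).prod (volume.restrict (Ioc a b))) := by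
  rw [Measure.prod_restrict]
  exact hf.mono_set (prod_mono_right Ioc_subset_Icc_self)

theorem intervalIntegral_setIntegral_eq {K : Set ℝ} {G : ℝ × ℝ → ℝ} {a b : ℝ} (hab : a ≤ b)
    (hG : IntegrableOn G (K ×ˢ Icc a b)) :
    ∫ τ in a..b, ∫ x in K, G (x, τ) = ∫ z in K ×ˢ Ioc a b, G z := by
  have h := integrableOn_prod_Ioc hG
  rw [intervalIntegral.integral_of_le hab, ← integral_prod_symm G h, Measure.prod_restrict]
  rfl

theorem setIntegral_intervalIntegral_eq {K : Set ℝ} {G : ℝ × ℝ → ℝ} {a b : ℝ} (hab : a ≤ b)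
    (hG : IntegrableOn G (K ×ˢ Icc a b)) :
    ∫ x in K, ∫ τ in a..b, G (x, τ) = ∫ z in K ×ˢ Ioc a b, G z := by
  have h := integrableOn_prod_Ioc hG
  simp only [intervalIntegral.integral_of_le hab]
  rw [← integral_prod G h, Measure.prod_restrict]
  rfl

theorem intervalIntegrable_setIntegral {K : Set ℝ} {G : ℝ × ℝ → ℝ} {a b : ℝ} (hab : a ≤ b)
    (hG : IntegrableOn G (K ×ˢ Icc a b)) :
    IntervalIntegrable (fun τ => ∫ x in K, G (x, τ)) volume a b := by
  rw [intervalIntegrable_iff_integrableOn_Ioc_of_le hab]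
  exact (integrableOn_prod_Ioc hG).integral_prod_right

theorem ContinuousOn.comp_slice {K : Set ℝ} {G : ℝ × ℝ → ℝ} {I : Set ℝ}
    (hG : ContinuousOn G (K ×ˢ I)) {τ : ℝ} (hτ : τ ∈ I) : ContinuousOn (fun x => G (x, τ)) K :=
  hG.comp (by fun_prop) fun _ hx => ⟨hx, hτ⟩

theorem continuous_slice {G : ℝ × ℝ → ℝ} {I : Set ℝ}
    (hG : ContinuousOn G (univ ×ˢ I)) {τ : ℝ} (hτ : τ ∈ I) : Continuous (fun x => G (x, τ)) :=
  continuousOn_univ.1 (hG.comp_slice hτ)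

/-- Distributional Kato inequality for the cubed positive part of a heat subsolution, tested
against compactly supported functions vanishing near `x = 0`. -/
theorem IsHeatSubsolution.kato_compact {T : ℝ} {y q g : ℝ → ℝ → ℝ}
    (H : IsHeatSubsolution T y q g) {s t : ℝ} (hs : 0 ≤ s) (hst : s ≤ t) (htT : t ≤ T)
    {δ R : ℝ} (hδ : 0 < δ) {φ φt φx : ℝ → ℝ → ℝ}
    (hφt : ∀ x, ∀ τ ∈ Icc s t, HasDerivAt (fun r => φ x r) (φt x τ) τ)
    (hφx : ∀ x, ∀ τ ∈ Icc s t, HasDerivAt (fun ξ => φ ξ τ) (φx x τ) x)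
    (hφc : ContinuousOn (fun z : ℝ × ℝ => φ z.1 z.2) (univ ×ˢ Icc s t))
    (hφtc : ContinuousOn (fun z : ℝ × ℝ => φt z.1 z.2) (univ ×ˢ Icc s t))
    (hφxc : ContinuousOn (fun z : ℝ × ℝ => φx z.1 z.2) (univ ×ˢ Icc s t))
    (hφ0 : ∀ x, ∀ τ ∈ Icc s t, 0 ≤ φ x τ)
    (hsupp : ∀ x, x ∉ annulus δ R → ∀ τ ∈ Icc s t, φ x τ = 0) :
    (∫ x in annulus δ R, φ x t * max (y x t) 0 ^ 3) -
        ∫ x in annulus δ R, φ x s * max (y x s) 0 ^ 3 ≤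
      ∫ τ in s..t, ∫ x in annulus δ R,
        (φt x τ * max (y x τ) 0 ^ 3 - φx x τ * (3 * max (y x τ) 0 ^ 2) * q x τ) := by
  set K := annulus δ R with hKdef
  have hK : IsCompact K := isCompact_annulus δ R
  have hsub : Icc s t ⊆ Icc 0 T := Icc_subset_Icc hs htT
  have cφ : ContinuousOn (fun z : ℝ × ℝ => φ z.1 z.2) (K ×ˢ Icc s t) :=
    hφc.mono (prod_mono_left (subset_univ _))
  have cφt : ContinuousOn (fun z : ℝ × ℝ => φt z.1 z.2) (K ×ˢ Icc s t) :=
    hφtc.mono (prod_mono_left (subset_univ _))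
  have cφx : ContinuousOn (fun z : ℝ × ℝ => φx z.1 z.2) (K ×ˢ Icc s t) :=
    hφxc.mono (prod_mono_left (subset_univ _))
  have cy : ContinuousOn (fun z : ℝ × ℝ => y z.1 z.2) (K ×ˢ Icc s t) :=
    H.cont.mono (prod_mono (subset_univ _) hsub)
  have cq : ContinuousOn (fun z : ℝ × ℝ => q z.1 z.2) (K ×ˢ Icc s t) :=
    H.cont_deriv.mono (prod_mono (subset_univ _) hsub)
  have ig : IntegrableOn (fun z : ℝ × ℝ => g z.1 z.2) (K ×ˢ Icc s t) :=
    (H.source_integrable δ hδ R).mono_set (prod_mono_right hsub)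
  have cyp : ContinuousOn (fun z : ℝ × ℝ => max (y z.1 z.2) 0) (K ×ˢ Icc s t) :=
    cy.sup continuousOn_const
  have cV : ContinuousOn (fun z : ℝ × ℝ => max (y z.1 z.2) 0 ^ 3) (K ×ˢ Icc s t) := cyp.pow 3
  have cf1 : ContinuousOn (fun z : ℝ × ℝ => φx z.1 z.2 * (3 * max (y z.1 z.2) 0 ^ 2))
      (K ×ˢ Icc s t) := cφx.mul (continuousOn_const.mul (cyp.pow 2))
  have cf2 : ContinuousOn (fun z : ℝ × ℝ => φ z.1 z.2 * (6 * max (y z.1 z.2) 0 * q z.1 z.2))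
      (K ×ˢ Icc s t) := cφ.mul ((continuousOn_const.mul cyp).mul cq)
  have cf3 : ContinuousOn (fun z : ℝ × ℝ => φ z.1 z.2 * (3 * max (y z.1 z.2) 0 ^ 2))
      (K ×ˢ Icc s t) := cφ.mul (continuousOn_const.mul (cyp.pow 2))
  obtain ⟨M1, hM1⟩ := H.bound
  obtain ⟨M2, hM2⟩ := (hK.prod isCompact_Icc).exists_bound_of_continuousOn cφt
  set M := max M1 M2 with hM
  have hqM : ∀ x, ∀ τ ∈ Icc s t, |q x τ| ≤ M := fun x τ hτ =>
    ((hM1 x τ (hsub hτ)).2).trans (le_max_left _ _)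
  have hφtM : ∀ x ∈ K, ∀ τ ∈ Icc s t, |φt x τ| ≤ M := fun x hx τ hτ =>
    (hM2 (x, τ) ⟨hx, hτ⟩).trans (le_max_right _ _)
  set Q : ℝ × ℝ → ℝ := fun z => φt z.1 z.2 * max (y z.1 z.2) 0 ^ 3 -
    φx z.1 z.2 * (3 * max (y z.1 z.2) 0 ^ 2) * q z.1 z.2 with hQ
  set P : ℝ × ℝ → ℝ := fun z => 3 * M + |g z.1 z.2| with hP
  have iQ : IntegrableOn Q (K ×ˢ Icc s t) :=
    ((cφt.mul cV).sub (cf1.mul cq)).integrableOn_compact (hK.prod isCompact_Icc)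
  have iP : IntegrableOn P (K ×ˢ Icc s t) :=
    (continuousOn_const.integrableOn_compact (hK.prod isCompact_Icc)).add ig.abs
  set E : ℝ → ℝ := fun τ => ∫ x in K, φ x τ * max (y x τ) 0 ^ 3 with hE
  have cE : ContinuousOn (fun z : ℝ × ℝ => φ z.1 z.2 * max (y z.1 z.2) 0 ^ 3) (K ×ˢ Icc s t) :=
    cφ.mul cV
  have local_step : ∀ ε > 0, ∃ δ' > 0, ∀ a b, s ≤ a → a ≤ b → b ≤ t → b - a < δ' →
      E b - E a ≤ ∫ τ in a..b, ∫ x in K, (Q (x, τ) + ε * P (x, τ)) := by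
    intro ε hε
    obtain ⟨δ1, hδ1, h1⟩ := cf1.exists_forall_abs_sub_le hK hε
    obtain ⟨δ2, hδ2, h2⟩ := cf2.exists_forall_abs_sub_le hK hε
    obtain ⟨δ3, hδ3, h3⟩ := cf3.exists_forall_abs_sub_le hK hε
    obtain ⟨δ4, hδ4, h4⟩ := cV.exists_forall_abs_sub_le hK hε
    refine ⟨min (min δ1 δ2) (min δ3 δ4), by positivity, fun a b hsa hab hbt hlt => ?_⟩
    have ha : a ∈ Icc s t := ⟨hsa, hab.trans hbt⟩
    have hb : b ∈ Icc s t := ⟨hsa.trans hab, hbt⟩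
    have hab' : Icc a b ⊆ Icc s t := Icc_subset_Icc hsa hbt
    set χ : ℝ → ℝ := fun x => φ x b * (3 * max (y x b) 0 ^ 2) with hχ
    set χ' : ℝ → ℝ := fun x => φx x b * (3 * max (y x b) 0 ^ 2) +
      φ x b * (6 * max (y x b) 0 * q x b) with hχ'
    have hχd : ∀ x, HasDerivAt χ (χ' x) x := fun x => by
      have hy := ((hasDerivAt_max_zero_pow 0 (y x b)).comp x (H.hasDerivAt b (hsub hb) x)).const_mul 3
      refine ((hφx x b hb).mul hy).congr_deriv ?_
      simp only [hχ', Nat.cast_zero, zero_add, pow_one, Function.comp]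
      ring
    have sφ := continuous_slice hφc hb
    have sφx := continuous_slice hφxc hb
    have sy := continuous_slice H.cont (hsub hb)
    have sq := continuous_slice H.cont_deriv (hsub hb)
    simp only at sφ sφx sy sq
    have hχ'c : Continuous χ' := by
      simp only [hχ']; fun_prop
    have hweak := H.weak δ hδ R χ χ' hχd hχ'c
      (fun x => mul_nonneg (hφ0 x b hb) (by positivity))
      (fun x hx => by simp only [hχ]; rw [hsupp x hx b hb, zero_mul])
      a b (hs.trans hsa) hab (hbt.trans htT)
    have cχ : ContinuousOn (fun z : ℝ × ℝ => χ z.1) (K ×ˢ Icc a b) := by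
      have : Continuous χ := by simp only [hχ]; fun_prop
      exact (this.comp continuous_fst).continuousOn
    have cχ' : ContinuousOn (fun z : ℝ × ℝ => χ' z.1) (K ×ˢ Icc a b) :=
      (hχ'c.comp continuous_fst).continuousOn
    have cVa : ContinuousOn (fun z : ℝ × ℝ => max (y z.1 a) 0 ^ 3) (K ×ˢ Icc a b) := by
      have sya := continuous_slice H.cont (hsub ha)
      simp only at sya
      have : Continuous fun x => max (y x a) 0 ^ 3 := by fun_prop
      exact (this.comp continuous_fst).continuousOn
    have hcomp : IsCompact (K ×ˢ Icc a b) := hK.prod isCompact_Icc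
    have mono' : K ×ˢ Icc a b ⊆ K ×ˢ Icc s t := prod_mono_right hab'
    have iG1 : IntegrableOn (fun z : ℝ × ℝ => χ' z.1 * q z.1 z.2 + χ z.1 * g z.1 z.2)
        (K ×ˢ Icc a b) :=
      ((cχ'.mul (cq.mono mono')).integrableOn_compact hcomp).add
        ((ig.mono_set mono').continuousOn_mul cχ hcomp)
    have iG2 : IntegrableOn (fun z : ℝ × ℝ => φt z.1 z.2 * max (y z.1 a) 0 ^ 3)
        (K ×ˢ Icc a b) :=
      ((cφt.mono mono').mul cVa).integrableOn_compact hcomp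
    have iE : ∀ τ ∈ Icc s t, IntegrableOn (fun x => φ x τ * max (y x τ) 0 ^ 3) K := fun τ hτ =>
      (cE.comp_slice hτ).integrableOn_compact hK
    have iy : IntegrableOn (fun x => χ x * (y x b - y x a)) K := by
      have sya := continuous_slice H.cont (hsub ha)
      simp only at sya
      have : Continuous fun x => χ x * (y x b - y x a) := by simp only [hχ]; fun_prop
      exact this.continuousOn.integrableOn_compact hK
    have iφ : IntegrableOn (fun x => (φ x b - φ x a) * max (y x a) 0 ^ 3) K := by
      have sya := continuous_slice H.cont (hsub ha)
      have sφa := continuous_slice hφc ha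
      simp only at sya sφa
      have : Continuous fun x => (φ x b - φ x a) * max (y x a) 0 ^ 3 := by fun_prop
      exact this.continuousOn.integrableOn_compact hK
    have e1 : E b - E a ≤ (∫ x in K, χ x * (y x b - y x a)) +
        ∫ x in K, (φ x b - φ x a) * max (y x a) 0 ^ 3 := by
      rw [← integral_add iy iφ, hE, ← integral_sub (iE b hb) (iE a ha)]
      refine setIntegral_mono ((iE b hb).sub (iE a ha)) (iy.add iφ) fun x => ?_
      have := mul_le_mul_of_nonneg_left (max_zero_pow_three_sub_le (y x a) (y x b)) (hφ0 x b hb)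
      simp only [hχ]
      linarith
    have e2 : ∫ x in K, (φ x b - φ x a) * max (y x a) 0 ^ 3 =
        ∫ z in K ×ˢ Ioc a b, φt z.1 z.2 * max (y z.1 a) 0 ^ 3 := by
      rw [← setIntegral_intervalIntegral_eq hab iG2]
      refine setIntegral_congr_fun hK.measurableSet fun x hx => ?_
      simp only [intervalIntegral.integral_mul_const]
      congr 1
      symm
      apply intervalIntegral.integral_eq_sub_of_hasDerivAt
      · intro τ hτ
        rw [uIcc_of_le hab] at hτ
        exact hφt x τ (hab' hτ)
      · apply ContinuousOn.intervalIntegrable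
        rw [uIcc_of_le hab]
        exact (hφtc.comp (f := fun τ => (x, τ)) (by fun_prop) fun τ hτ => ⟨mem_univ _, hab' hτ⟩)
    have e3 := intervalIntegral_setIntegral_eq hab iG1
    have iR : IntegrableOn (fun z => Q z + ε * P z) (K ×ˢ Icc a b) :=
      (iQ.mono_set mono').add ((iP.mono_set mono').const_mul ε)
    have e4 := intervalIntegral_setIntegral_eq hab iR
    simp only at e3 e4
    rw [e3] at hweak
    rw [e4]
    have mIoc : K ×ˢ Ioc a b ⊆ K ×ˢ Icc a b := prod_mono_right Ioc_subset_Icc_self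
    have e5 : -(∫ z in K ×ˢ Ioc a b, (χ' z.1 * q z.1 z.2 + χ z.1 * g z.1 z.2)) +
        ∫ z in K ×ˢ Ioc a b, φt z.1 z.2 * max (y z.1 a) 0 ^ 3 ≤
        ∫ z in K ×ˢ Ioc a b, (Q z + ε * P z) := by
      have iN : IntegrableOn (fun z : ℝ × ℝ => -(χ' z.1 * q z.1 z.2 + χ z.1 * g z.1 z.2))
          (K ×ˢ Ioc a b) := (iG1.mono_set mIoc).neg
      rw [← integral_neg, ← integral_add iN (iG2.mono_set mIoc)]
      refine setIntegral_mono_on (iN.add (iG2.mono_set mIoc))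
        (iR.mono_set mIoc) (hK.measurableSet.prod measurableSet_Ioc) ?_
      rintro ⟨x, τ⟩ ⟨hx, hτ⟩
      have hτ' : τ ∈ Icc s t := hab' (Ioc_subset_Icc_self hτ)
      have hlt' : |b - τ| < min (min δ1 δ2) (min δ3 δ4) := by
        rw [abs_of_nonneg (by linarith [hτ.2])]; linarith [hτ.1]
      have hlt'' : |τ - a| < min (min δ1 δ2) (min δ3 δ4) := by
        rw [abs_of_nonneg (by linarith [hτ.1])]; linarith [hτ.2]
      simp only [lt_min_iff] at hlt' hlt''
      have b1 := h1 x hx b hb τ hτ' hlt'.1.1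
      have b2 := h2 x hx b hb τ hτ' hlt'.1.2
      have b3 := h3 x hx b hb τ hτ' hlt'.2.1
      have b4 := h4 x hx τ hτ' a ha hlt''.2.2
      simp only at b1 b2 b3 b4 hx hτ
      have c1 := mul_le_mul b1 (hqM x τ hτ') (abs_nonneg _) hε.le
      have c2 := mul_le_mul b2 (hqM x τ hτ') (abs_nonneg _) hε.le
      have c3 := mul_le_mul_of_nonneg_right b3 (abs_nonneg (g x τ))
      have c4 := mul_le_mul b4 (hφtM x hx τ hτ') (abs_nonneg _) hε.le
      rw [← abs_mul] at c1 c2 c3 c4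
      have d1 := (abs_le.1 c1).1
      have d2 := (abs_le.1 c2).1
      have d3 := (abs_le.1 c3).1
      have d4 := (abs_le.1 c4).1
      have n2 : 0 ≤ φ x τ * (6 * max (y x τ) 0 * q x τ) * q x τ := by
        have : φ x τ * (6 * max (y x τ) 0 * q x τ) * q x τ =
          φ x τ * (6 * max (y x τ) 0) * q x τ ^ 2 := by ring
        rw [this]
        have := hφ0 x τ hτ'
        positivity
      have n3 : 0 ≤ φ x τ * (3 * max (y x τ) 0 ^ 2) * g x τ := by
        have := hφ0 x τ hτ'
        rcases le_or_gt (y x τ) 0 with hy | hy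
        · rw [max_eq_right hy]; simp
        · have := H.source_nonneg x τ (hsub hτ') hy
          positivity
      simp only [hQ, hP, hχ, hχ']
      linarith
    linarith
  have final : ∀ ε > 0, E t - E s ≤ (∫ τ in s..t, ∫ x in K, Q (x, τ)) +
      ε * ∫ τ in s..t, ∫ x in K, P (x, τ) := by
    intro ε hε
    obtain ⟨δ', hδ', hloc⟩ := local_step ε hε
    have iR : IntegrableOn (fun z => Q z + ε * P z) (K ×ˢ Icc s t) := iQ.add (iP.const_mul ε)
    have ii := intervalIntegrable_setIntegral hst iR
    have ii' : ∀ a ∈ Icc s t, ∀ b ∈ Icc s t, IntervalIntegrable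
        (fun τ => ∫ x in K, (Q (x, τ) + ε * P (x, τ))) volume a b := fun a ha b hb => by
      refine ii.mono_set ?_
      rw [uIcc_of_le hst]
      exact uIcc_subset_Icc ha hb
    have hmem : s ∈ Icc s t := ⟨le_rfl, hst⟩
    have := le_of_locally_le
      (f := fun r => E r - ∫ τ in s..r, ∫ x in K, (Q (x, τ) + ε * P (x, τ))) hst hδ'
      (fun a b hsa hab hbt hlt => by
        have h1 := hloc a b hsa hab hbt hlt
        have h2 := intervalIntegral.integral_add_adjacent_intervals
          (ii' s hmem a ⟨hsa, hab.trans hbt⟩)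
          (ii' a ⟨hsa, hab.trans hbt⟩ b ⟨hsa.trans hab, hbt⟩)
        linarith)
    simp only [intervalIntegral.integral_same, sub_zero] at this
    have e1 := intervalIntegral_setIntegral_eq hst iR
    have e2 := intervalIntegral_setIntegral_eq hst iQ
    have e3 := intervalIntegral_setIntegral_eq hst iP
    have mIoc : K ×ˢ Ioc s t ⊆ K ×ˢ Icc s t := prod_mono_right Ioc_subset_Icc_self
    rw [integral_add (iQ.mono_set mIoc) ((iP.mono_set mIoc).const_mul ε),
      integral_const_mul] at e1
    rw [e1] at this
    rw [e2, e3]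
    linarith
  have hlim : Tendsto (fun ε : ℝ => (∫ τ in s..t, ∫ x in K, Q (x, τ)) +
      ε * ∫ τ in s..t, ∫ x in K, P (x, τ)) (nhdsWithin 0 (Ioi 0))
      (nhds ((∫ τ in s..t, ∫ x in K, Q (x, τ)) + 0 * ∫ τ in s..t, ∫ x in K, P (x, τ))) := by
    refine Tendsto.mono_left ?_ nhdsWithin_le_nhds
    exact Continuous.tendsto (by fun_prop) 0
  have := ge_of_tendsto hlim (by
    filter_upwards [self_mem_nhdsWithin] with ε hε using final ε hε)
  simpa using this

theorem exists_smooth_step : ∃ k k' : ℝ → ℝ, ∃ C, (∀ x, HasDerivAt k (k' x) x) ∧ Continuous k' ∧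
    (∀ x, 0 ≤ k x ∧ k x ≤ 1) ∧ (∀ x, |x| ≤ 1 → k x = 0) ∧ (∀ x, 2 ≤ |x| → k x = 1) ∧
    (∀ x, |k' x| ≤ C) ∧ (∀ x, 2 ≤ |x| → k' x = 0) := by
  set k : ℝ → ℝ := fun x => Real.smoothTransition (x ^ 2 - 1) with hk
  have hkd : ContDiff ℝ 1 k := Real.smoothTransition.contDiff.comp (by fun_prop)
  have h01 : ∀ x, 0 ≤ k x ∧ k x ≤ 1 := fun x =>
    ⟨Real.smoothTransition.nonneg _, Real.smoothTransition.le_one _⟩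
  have h1 : ∀ x, 2 ≤ |x| → k x = 1 := fun x hx => by
    refine Real.smoothTransition.one_of_one_le ?_
    have : x ^ 2 = |x| ^ 2 := (sq_abs x).symm
    nlinarith
  have hz : ∀ x, 2 ≤ |x| → deriv k x = 0 := fun x hx => by
    refine IsLocalMax.deriv_eq_zero (Eventually.of_forall fun z => ?_)
    rw [h1 x hx]
    exact (h01 z).2
  have hc : Continuous (deriv k) := hkd.continuous_deriv le_rfl
  obtain ⟨C, hC⟩ := (isCompact_Icc (a := (-2 : ℝ)) (b := 2)).exists_bound_of_continuousOn
    hc.continuousOn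
  refine ⟨k, deriv k, C, fun x => (hkd.differentiable (by norm_num) x).hasDerivAt, hc, h01,
    fun x hx => ?_, h1, fun x => ?_, hz⟩
  · refine Real.smoothTransition.zero_of_nonpos ?_
    have : x ^ 2 = |x| ^ 2 := (sq_abs x).symm
    nlinarith [abs_nonneg x]
  · rcases le_or_gt 2 |x| with h | h
    · rw [hz x h, abs_zero]
      exact (norm_nonneg _).trans (hC 0 ⟨by norm_num, by norm_num⟩)
    · exact hC x ⟨(abs_lt.1 h).1.le, (abs_lt.1 h).2.le⟩

/-- Cutoffs supported in annuli and exhausting `ℝ \ {0}`, with the natural derivative bounds. -/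
theorem exists_cutoff : ∃ χ χ' : ℕ → ℝ → ℝ, ∃ C, (∀ n x, HasDerivAt (χ n) (χ' n x) x) ∧
    (∀ n, Continuous (χ' n)) ∧ (∀ n x, 0 ≤ χ n x ∧ χ n x ≤ 1) ∧
    (∀ n, ∃ δ > 0, ∃ R, ∀ x, x ∉ annulus δ R → χ n x = 0 ∧ χ' n x = 0) ∧
    (∀ x, x ≠ 0 → Tendsto (fun n => χ n x) atTop (nhds 1)) ∧ 0 ≤ C ∧
    (∀ n : ℕ, ∀ x, |χ' n x| ≤ C * ((Icc (-(2 / ((n : ℝ) + 2))) (2 / ((n : ℝ) + 2))).indicator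
      (fun _ => (n : ℝ) + 2) x + 1 / ((n : ℝ) + 2))) := by
  obtain ⟨k, k', C, hk, hk', h01, hk0, hk1, hC, hk'0⟩ := exists_smooth_step
  have hC0 : 0 ≤ C := (abs_nonneg _).trans (hC 0)
  have hkc : Continuous k := continuous_iff_continuousAt.2 fun x => (hk x).continuousAt
  have hk00 : ∀ x, |x| ≤ 1 → k' x = 0 := fun x hx => by
    rw [← (hk x).deriv]
    refine IsLocalMin.deriv_eq_zero (Eventually.of_forall fun z => ?_)
    rw [hk0 x hx]
    exact (h01 z).1
  refine ⟨fun n x => k (((n : ℝ) + 2) * x) * (1 - k (x / ((n : ℝ) + 2))),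
    fun n x => ((n : ℝ) + 2) * k' (((n : ℝ) + 2) * x) * (1 - k (x / ((n : ℝ) + 2))) -
      k (((n : ℝ) + 2) * x) * (k' (x / ((n : ℝ) + 2)) / ((n : ℝ) + 2)), C, fun n x => ?_, fun n => ?_,
      fun n x => ?_, fun n => ⟨1 / ((n : ℝ) + 2), by positivity, 2 * ((n : ℝ) + 2), fun x hx => ?_⟩,
      fun x hx => ?_, hC0, fun n x => ?_⟩
  · have e1 := (hk (((n : ℝ) + 2) * x)).comp x ((hasDerivAt_id x).const_mul ((n : ℝ) + 2))
    have e2 := (hk (x / ((n : ℝ) + 2))).comp x ((hasDerivAt_id x).div_const ((n : ℝ) + 2))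
    refine (e1.mul (e2.const_sub 1)).congr_deriv ?_
    simp only [id, Function.comp]
    ring
  · fun_prop
  · have a1 := h01 (((n : ℝ) + 2) * x)
    have a2 := h01 (x / ((n : ℝ) + 2))
    exact ⟨mul_nonneg a1.1 (by linarith), mul_le_one₀ a1.2 (by linarith) (by linarith)⟩
  · have hm : (0 : ℝ) < (n : ℝ) + 2 := by positivity
    rw [annulus, mem_ofPred_eq, not_and_or, not_le, not_le] at hx
    rcases hx with hx | hx
    · have : |((n : ℝ) + 2) * x| ≤ 1 := by
        rw [abs_mul, abs_of_pos hm, mul_comm]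
        exact ((lt_div_iff₀ hm).1 hx).le
      simp [hk0 _ this, hk00 _ this]
    · have : 2 ≤ |x / ((n : ℝ) + 2)| := by
        rw [abs_div, abs_of_pos hm]
        exact ((lt_div_iff₀ hm).2 hx).le
      simp [hk1 _ this, hk'0 _ this]
  · refine tendsto_const_nhds.congr' ?_
    filter_upwards [tendsto_natCast_atTop_atTop.eventually_ge_atTop (2 / |x|),
      tendsto_natCast_atTop_atTop.eventually_ge_atTop |x|] with n h1 h2
    have hx' : 0 < |x| := abs_pos.2 hx
    have hm : (0 : ℝ) < (n : ℝ) + 2 := by positivity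
    rw [hk1, hk0]
    · norm_num
    · rw [abs_div, abs_of_pos hm, div_le_one hm]; linarith
    · rw [abs_mul, abs_of_pos hm]
      rw [div_le_iff₀ hx'] at h1
      nlinarith
  · have hm : (0 : ℝ) < (n : ℝ) + 2 := by positivity
    have a1 := h01 (((n : ℝ) + 2) * x)
    have a2 := h01 (x / ((n : ℝ) + 2))
    rw [mul_add]
    refine (abs_sub _ _).trans (add_le_add ?_ ?_)
    · rw [abs_mul, abs_mul, abs_of_pos hm, abs_of_nonneg (a := 1 - _) (by linarith)]
      by_cases hx : x ∈ Icc (-(2 / ((n : ℝ) + 2))) (2 / ((n : ℝ) + 2))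
      · rw [indicator_of_mem hx]
        calc ((n : ℝ) + 2) * |k' (((n : ℝ) + 2) * x)| * (1 - k (x / ((n : ℝ) + 2)))
            ≤ ((n : ℝ) + 2) * |k' (((n : ℝ) + 2) * x)| * 1 := by gcongr; linarith
          _ ≤ ((n : ℝ) + 2) * C * 1 := by gcongr; exact hC _
          _ = _ := by ring
      · rw [indicator_of_notMem hx, hk'0]
        · simp
        · rw [mem_Icc, ← abs_le, not_le, div_lt_iff₀ hm] at hx
          rw [abs_mul, abs_of_pos hm]; linarith
    · rw [abs_mul, abs_div, abs_of_pos hm, abs_of_nonneg a1.1, mul_one_div]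
      calc k (((n : ℝ) + 2) * x) * (|k' (x / ((n : ℝ) + 2))| / ((n : ℝ) + 2))
          ≤ 1 * (C / ((n : ℝ) + 2)) := by gcongr; exacts [a1.2, hC _]
        _ = _ := one_mul _

theorem exists_uniform_small_near_zero {r : ℝ → ℝ → ℝ} {s t : ℝ}
    (hr : ContinuousOn (fun z : ℝ × ℝ => r z.1 z.2) (univ ×ˢ Icc s t))
    (h0 : ∀ τ ∈ Icc s t, r 0 τ = 0) {ε : ℝ} (hε : 0 < ε) :
    ∃ δ > 0, ∀ x, |x| ≤ δ → ∀ τ ∈ Icc s t, |r x τ| ≤ ε := by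
  have hc : ContinuousOn (fun z : ℝ × ℝ => r z.1 z.2) (Icc (-1) 1 ×ˢ Icc s t) :=
    hr.mono (prod_mono_left (subset_univ _))
  have := (isCompact_Icc.prod isCompact_Icc).uniformContinuousOn_of_continuous hc
  rw [Metric.uniformContinuousOn_iff] at this
  obtain ⟨δ, hδ, h⟩ := this ε hε
  refine ⟨min (δ / 2) 1, by positivity, fun x hx τ hτ => ?_⟩
  have hx1 : |x| ≤ 1 := hx.trans (min_le_right _ _)
  have hx2 : |x| < δ := (hx.trans (min_le_left _ _)).trans_lt (by linarith)
  have := h (x, τ) ⟨⟨(abs_le.1 hx1).1, (abs_le.1 hx1).2⟩, hτ⟩ (0, τ) ⟨⟨by norm_num, by norm_num⟩, hτ⟩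
    (by simpa [Prod.dist_eq] using hx2)
  rw [Real.dist_eq] at this
  simp only [h0 τ hτ, sub_zero] at this
  exact this.le

theorem integrableOn_prod_of_dominated {F : ℝ × ℝ → ℝ} {s t c : ℝ} {D : ℝ → ℝ}
    (hF : ContinuousOn F (univ ×ˢ Icc s t)) (hD : Integrable D)
    (hb : ∀ x, ∀ τ ∈ Icc s t, |F (x, τ)| ≤ c * D x) :
    IntegrableOn F (univ ×ˢ Icc s t) := by
  have h1 : IntegrableOn (fun z : ℝ × ℝ => c * D z.1) (univ ×ˢ Icc s t) := by
    rw [IntegrableOn, Measure.volume_eq_prod, ← Measure.prod_restrict, Measure.restrict_univ]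
    exact (hD.const_mul c).comp_fst _
  have hm : MeasurableSet ((univ : Set ℝ) ×ˢ Icc s t) := MeasurableSet.univ.prod measurableSet_Icc
  refine Integrable.mono' h1 (hF.aestronglyMeasurable hm) ?_
  exact (ae_restrict_iff' hm).2 (Eventually.of_forall fun z hz => hb z.1 z.2 hz.2)

/-- Distributional Kato inequality tested against integrable test functions on the whole line. -/
theorem IsHeatSubsolution.kato {T : ℝ} {y q g : ℝ → ℝ → ℝ}
    (H : IsHeatSubsolution T y q g) {s t : ℝ} (hs : 0 ≤ s) (hst : s ≤ t) (htT : t ≤ T)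
    {φ φt φx : ℝ → ℝ → ℝ} {D : ℝ → ℝ} {D0 : ℝ}
    (hφt : ∀ x, ∀ τ ∈ Icc s t, HasDerivAt (fun r => φ x r) (φt x τ) τ)
    (hφx : ∀ x, ∀ τ ∈ Icc s t, HasDerivAt (fun ξ => φ ξ τ) (φx x τ) x)
    (hφc : ContinuousOn (fun z : ℝ × ℝ => φ z.1 z.2) (univ ×ˢ Icc s t))
    (hφtc : ContinuousOn (fun z : ℝ × ℝ => φt z.1 z.2) (univ ×ˢ Icc s t))
    (hφxc : ContinuousOn (fun z : ℝ × ℝ => φx z.1 z.2) (univ ×ˢ Icc s t))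
    (hφ0 : ∀ x, ∀ τ ∈ Icc s t, 0 ≤ φ x τ)
    (hD : Integrable D) (hD0 : ∀ x, D x ≤ D0)
    (hφD : ∀ x, ∀ τ ∈ Icc s t, φ x τ ≤ D x)
    (hφtD : ∀ x, ∀ τ ∈ Icc s t, |φt x τ| ≤ D x)
    (hφxD : ∀ x, ∀ τ ∈ Icc s t, |φx x τ| ≤ D x) :
    (∫ x, φ x t * max (y x t) 0 ^ 3) - ∫ x, φ x s * max (y x s) 0 ^ 3 ≤
      ∫ τ in s..t, ∫ x,
        (φt x τ * max (y x τ) 0 ^ 3 - φx x τ * (3 * max (y x τ) 0 ^ 2 * q x τ)) := by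
  obtain ⟨M0, hM0⟩ := H.bound
  have hsub : Icc s t ⊆ Icc 0 T := Icc_subset_Icc hs htT
  have htm : t ∈ Icc s t := ⟨hst, le_rfl⟩
  have hsm : s ∈ Icc s t := ⟨le_rfl, hst⟩
  have hM00 : 0 ≤ M0 := (abs_nonneg _).trans (hM0 0 t (hsub htm)).1
  have hDnn : ∀ x, 0 ≤ D x := fun x => (hφ0 x t htm).trans (hφD x t htm)
  have hD00 : 0 ≤ D0 := (hDnn 0).trans (hD0 0)
  have cy : ContinuousOn (fun z : ℝ × ℝ => y z.1 z.2) (univ ×ˢ Icc s t) :=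
    H.cont.mono (prod_mono_right hsub)
  have cq : ContinuousOn (fun z : ℝ × ℝ => q z.1 z.2) (univ ×ˢ Icc s t) :=
    H.cont_deriv.mono (prod_mono_right hsub)
  have cyp : ContinuousOn (fun z : ℝ × ℝ => max (y z.1 z.2) 0) (univ ×ˢ Icc s t) :=
    cy.sup continuousOn_const
  set V : ℝ → ℝ → ℝ := fun x τ => max (y x τ) 0 ^ 3 with hV
  set r : ℝ → ℝ → ℝ := fun x τ => 3 * max (y x τ) 0 ^ 2 * q x τ with hr
  have cV : ContinuousOn (fun z : ℝ × ℝ => V z.1 z.2) (univ ×ˢ Icc s t) := cyp.pow 3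
  have cr : ContinuousOn (fun z : ℝ × ℝ => r z.1 z.2) (univ ×ˢ Icc s t) :=
    (continuousOn_const.mul (cyp.pow 2)).mul cq
  have hr0 : ∀ τ ∈ Icc s t, r 0 τ = 0 := fun τ hτ => by
    rcases le_or_gt (y 0 τ) 0 with h | h
    · simp [hr, max_eq_right h]
    · simp [hr, H.neumann τ (hsub hτ) h]
  have hyp : ∀ x, ∀ τ ∈ Icc s t, max (y x τ) 0 ≤ M0 := fun x τ hτ =>
    max_le ((le_abs_self _).trans (hM0 x τ (hsub hτ)).1) hM00
  set M : ℝ := 3 * M0 ^ 3 with hM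
  have hMnn : 0 ≤ M := by positivity
  have hVnn : ∀ x τ, 0 ≤ V x τ := fun x τ => by simp only [hV]; positivity
  have hVM : ∀ x, ∀ τ ∈ Icc s t, |V x τ| ≤ M := fun x τ hτ => by
    rw [abs_of_nonneg (hVnn x τ)]
    have := pow_le_pow_left₀ (le_max_right _ _) (hyp x τ hτ) 3
    simp only [hV, hM]
    nlinarith [pow_nonneg hM00 3]
  have hrM : ∀ x, ∀ τ ∈ Icc s t, |r x τ| ≤ M := fun x τ hτ => by
    have h2 := pow_le_pow_left₀ (le_max_right _ _) (hyp x τ hτ) 2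
    simp only [hr, hM, abs_mul, abs_pow]
    rw [abs_of_nonneg (le_max_right (y x τ) 0), abs_of_nonneg (by norm_num : (0:ℝ) ≤ 3)]
    calc 3 * max (y x τ) 0 ^ 2 * |q x τ| ≤ 3 * M0 ^ 2 * M0 := by
          gcongr; exact (hM0 x τ (hsub hτ)).2
      _ = _ := by ring
  set F : ℝ × ℝ → ℝ := fun z => φt z.1 z.2 * V z.1 z.2 - φx z.1 z.2 * r z.1 z.2 with hF
  have cF : ContinuousOn F (univ ×ˢ Icc s t) := (hφtc.mul cV).sub (hφxc.mul cr)
  have hFD : ∀ x, ∀ τ ∈ Icc s t, |F (x, τ)| ≤ (2 * M) * D x := fun x τ hτ => by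
    have h1 := mul_le_mul (hφtD x τ hτ) (hVM x τ hτ) (abs_nonneg _) (hDnn x)
    have h2 := mul_le_mul (hφxD x τ hτ) (hrM x τ hτ) (abs_nonneg _) (hDnn x)
    rw [← abs_mul] at h1 h2
    refine (abs_sub _ _).trans ?_
    simp only
    linarith
  have iF : IntegrableOn F (univ ×ˢ Icc s t) := integrableOn_prod_of_dominated cF hD hFD
  obtain ⟨χ, χ', C, hχ, hχ'c, hχ01, hχsupp, hχlim, hC0, hχ'⟩ := exists_cutoff
  have hχc : ∀ n, Continuous (χ n) := fun n =>
    continuous_iff_continuousAt.2 fun x => (hχ n x).continuousAt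
  have mS : MeasurableSet ((univ : Set ℝ) ×ˢ Ioc s t) := MeasurableSet.univ.prod measurableSet_Ioc
  have sS : (univ : Set ℝ) ×ˢ Ioc s t ⊆ univ ×ˢ Icc s t := prod_mono_right Ioc_subset_Icc_self
  have lim_slice : ∀ τ ∈ Icc s t, Tendsto (fun n => ∫ x, φ x τ * χ n x * V x τ) atTop
      (nhds (∫ x, φ x τ * V x τ)) := by
    intro τ hτ
    have sφ := continuous_slice hφc hτ
    have sV := continuous_slice cV hτ
    simp only at sφ sV
    refine tendsto_integral_of_dominated_convergence (fun x => M * D x) (fun n => ?_)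
      (hD.const_mul M) (fun n => Eventually.of_forall fun x => ?_) ?_
    · have := hχc n
      exact Continuous.aestronglyMeasurable (by fun_prop)
    · rw [Real.norm_eq_abs, abs_mul, abs_mul, abs_of_nonneg (hφ0 x τ hτ),
        abs_of_nonneg (hχ01 n x).1]
      calc φ x τ * χ n x * |V x τ| ≤ D x * 1 * M := by
            have := hφ0 x τ hτ
            have := (hχ01 n x).1
            have := hDnn x
            gcongr
            exacts [hφD x τ hτ, (hχ01 n x).2, hVM x τ hτ]
        _ = _ := by ring
    · have : ∀ᵐ x : ℝ, x ≠ 0 := by simp [ae_iff]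
      filter_upwards [this] with x hx
      simpa using ((hχlim x hx).const_mul (φ x τ)).mul_const (V x τ)
  have lim_F : Tendsto (fun n => ∫ z in univ ×ˢ Ioc s t, χ n z.1 * F z) atTop
      (nhds (∫ z in univ ×ˢ Ioc s t, F z)) := by
    refine tendsto_integral_of_dominated_convergence (fun z => ‖F z‖) (fun n => ?_)
      (iF.mono_set sS).norm (fun n => Eventually.of_forall fun x => ?_) ?_
    · exact ((hχc n).comp continuous_fst).aestronglyMeasurable.mul
        (iF.mono_set sS).aestronglyMeasurable
    · rw [norm_mul, Real.norm_eq_abs, abs_of_nonneg (hχ01 n _).1]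
      exact mul_le_of_le_one_left (norm_nonneg _) (hχ01 n _).2
    · have h0 : ∀ᵐ x : ℝ, x ≠ 0 := by simp [ae_iff]
      have h1 : ∀ᵐ z ∂((volume : Measure ℝ).prod (volume.restrict (Ioc s t))), z.1 ≠ 0 :=
        Measure.quasiMeasurePreserving_fst.ae h0
      rw [Measure.volume_eq_prod, ← Measure.prod_restrict, Measure.restrict_univ]
      filter_upwards [h1] with z hz
      simpa using (hχlim z.1 hz).mul_const (F z)
  have key : ∀ ε > 0, ∀ᶠ n : ℕ in atTop,
      (∫ x, φ x t * χ n x * V x t) - ∫ x, φ x s * χ n x * V x s ≤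
      (∫ z in univ ×ˢ Ioc s t, χ n z.1 * F z) +
        (t - s) * (C * (4 * D0 * ε) + C * M * (∫ x, D x) / ((n : ℝ) + 2)) := by
    intro ε hε
    obtain ⟨δ, hδ, hsmall⟩ := exists_uniform_small_near_zero cr hr0 hε
    filter_upwards [tendsto_natCast_atTop_atTop.eventually_ge_atTop (2 / δ)] with n hn
    have hm : (0 : ℝ) < (n : ℝ) + 2 := by positivity
    have hnδ : 2 / ((n : ℝ) + 2) ≤ δ := by
      rw [div_le_iff₀ hδ] at hn
      rw [div_le_iff₀ hm]
      nlinarith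
    obtain ⟨δ', hδ', R, hsupp⟩ := hχsupp n
    set K := annulus δ' R with hK
    have sχ := hχc n
    have sχ' := hχ'c n
    have cχ : ContinuousOn (fun z : ℝ × ℝ => χ n z.1) (univ ×ˢ Icc s t) :=
      (sχ.comp continuous_fst).continuousOn
    have cχ' : ContinuousOn (fun z : ℝ × ℝ => χ' n z.1) (univ ×ˢ Icc s t) :=
      (sχ'.comp continuous_fst).continuousOn
    have h := H.kato_compact hs hst htT hδ' (R := R)
      (φ := fun x τ => φ x τ * χ n x) (φt := fun x τ => φt x τ * χ n x)
      (φx := fun x τ => φx x τ * χ n x + φ x τ * χ' n x)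
      (fun x τ hτ => (hφt x τ hτ).mul_const _) (fun x τ hτ => (hφx x τ hτ).mul (hχ n x))
      (hφc.mul cχ) (hφtc.mul cχ) ((hφxc.mul cχ).add (hφc.mul cχ'))
      (fun x τ hτ => mul_nonneg (hφ0 x τ hτ) (hχ01 n x).1)
      (fun x hx τ _ => by rw [(hsupp x hx).1, mul_zero])
    rw [← hK, setIntegral_eq_integral_of_forall_compl_eq_zero
        (fun x hx => by rw [(hsupp x hx).1]; ring),
      setIntegral_eq_integral_of_forall_compl_eq_zero
        (fun x hx => by rw [(hsupp x hx).1]; ring)] at h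
    refine h.trans ?_
    set I : ℝ → ℝ := (Icc (-(2 / ((n : ℝ) + 2))) (2 / ((n : ℝ) + 2))).indicator
      (fun _ => (n : ℝ) + 2) with hI
    set B : ℝ → ℝ := fun x => C * (D0 * ε) * I x + C * M / ((n : ℝ) + 2) * D x with hB
    have iI : Integrable I := by
      rw [hI, integrable_indicator_iff measurableSet_Icc]
      exact continuousOn_const.integrableOn_compact isCompact_Icc
    have vI : ∫ x, I x = 4 := by
      rw [hI, integral_indicator_const _ measurableSet_Icc]
      simp only [Measure.real, Real.volume_Icc, smul_eq_mul]
      rw [ENNReal.toReal_ofReal (by rw [sub_neg_eq_add]; positivity)]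
      field_simp
      norm_num
    have iB : Integrable B := (iI.const_mul _).add (hD.const_mul _)
    have iB2 : IntegrableOn (fun z : ℝ × ℝ => B z.1) (univ ×ˢ Ioc s t) := by
      rw [IntegrableOn, Measure.volume_eq_prod, ← Measure.prod_restrict, Measure.restrict_univ]
      exact iB.comp_fst _
    have vB : ∫ z in univ ×ˢ Ioc s t, B z.1 = (t - s) *
        (C * (4 * D0 * ε) + C * M * (∫ x, D x) / ((n : ℝ) + 2)) := by
      rw [Measure.volume_eq_prod, ← Measure.prod_restrict, Measure.restrict_univ,
        integral_fun_fst, hB, integral_add (iI.const_mul _) (hD.const_mul _), integral_const_mul,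
        integral_const_mul, vI]
      simp only [Measure.real, smul_eq_mul, Measure.restrict_apply_univ, Real.volume_Ioc]
      rw [ENNReal.toReal_ofReal (by linarith)]
      ring
    rw [← vB]
    have hG : ∀ τ, ∫ x in K, (φt x τ * χ n x * max (y x τ) 0 ^ 3 -
        (φx x τ * χ n x + φ x τ * χ' n x) * (3 * max (y x τ) 0 ^ 2) * q x τ) =
        ∫ x in univ, (fun z : ℝ × ℝ => χ n z.1 * F z - φ z.1 z.2 * χ' n z.1 * r z.1 z.2) (x, τ) := by
      intro τ
      rw [setIntegral_eq_integral_of_forall_compl_eq_zero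
        (fun x hx => by rw [(hsupp x hx).1, (hsupp x hx).2]; ring), setIntegral_univ]
      refine integral_congr_ae (Eventually.of_forall fun x => ?_)
      simp only [hF, hV, hr]
      ring
    simp only [hG]
    have iG1 : IntegrableOn (fun z : ℝ × ℝ => χ n z.1 * F z) (univ ×ˢ Icc s t) := by
      refine integrableOn_prod_of_dominated (cχ.mul cF) hD (c := 2 * M) fun x τ hτ => ?_
      rw [abs_mul, abs_of_nonneg (hχ01 n x).1]
      exact (mul_le_of_le_one_left (abs_nonneg _) (hχ01 n x).2).trans (hFD x τ hτ)
    have hχ'B : ∀ x, ∀ τ ∈ Icc s t, |φ x τ * χ' n x * r x τ| ≤ B x := fun x τ hτ => by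
      have hIn : 0 ≤ I x := indicator_nonneg (fun _ _ => hm.le) x
      have e1 : |φ x τ * χ' n x * r x τ| ≤ D x * (C * (I x + 1 / ((n : ℝ) + 2))) * |r x τ| := by
        rw [abs_mul, abs_mul, abs_of_nonneg (hφ0 x τ hτ)]
        have := hDnn x
        gcongr
        exacts [hφD x τ hτ, hχ' n x]
      have e2 : I x * |r x τ| ≤ I x * ε := by
        by_cases hx : x ∈ Icc (-(2 / ((n : ℝ) + 2))) (2 / ((n : ℝ) + 2))
        · exact mul_le_mul_of_nonneg_left (hsmall x ((abs_le.2 hx).trans hnδ) τ hτ) hIn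
        · simp only [hI, indicator_of_notMem hx, zero_mul, le_refl]
      have e3 : D x * (I x * ε) ≤ D0 * (I x * ε) :=
        mul_le_mul_of_nonneg_right (hD0 x) (by positivity)
      have e4 := mul_le_mul_of_nonneg_left e2 (hDnn x)
      have e5 := mul_le_mul_of_nonneg_left (hrM x τ hτ)
        (mul_nonneg (hDnn x) (by positivity : 0 ≤ 1 / ((n : ℝ) + 2)))
      have e6 := mul_le_mul_of_nonneg_left (add_le_add (e4.trans e3) e5) hC0
      refine e1.trans (le_trans (le_of_eq ?_) (e6.trans (le_of_eq ?_)))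
      · ring
      · simp only [hB]; ring
    have iG2 : IntegrableOn (fun z : ℝ × ℝ => φ z.1 z.2 * χ' n z.1 * r z.1 z.2)
        (univ ×ˢ Icc s t) :=
      integrableOn_prod_of_dominated ((hφc.mul cχ').mul cr) iB (c := 1)
        fun x τ hτ => by rw [one_mul]; exact hχ'B x τ hτ
    have iG : IntegrableOn (fun z : ℝ × ℝ => χ n z.1 * F z - φ z.1 z.2 * χ' n z.1 * r z.1 z.2)
        (univ ×ˢ Icc s t) := iG1.sub iG2
    have e := intervalIntegral_setIntegral_eq hst iG
    simp only at e
    rw [e, ← integral_add (iG1.mono_set sS) iB2]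
    refine setIntegral_mono_on (iG.mono_set sS) ((iG1.mono_set sS).add iB2) mS
      fun z hz => ?_
    have := (abs_le.1 (hχ'B z.1 z.2 (Ioc_subset_Icc_self hz.2))).1
    linarith
  have lim_n : ∀ ε > 0, (∫ x, φ x t * V x t) - ∫ x, φ x s * V x s ≤
      (∫ z in univ ×ˢ Ioc s t, F z) + (t - s) * (C * (4 * D0 * ε) + 0) := by
    intro ε hε
    refine le_of_tendsto_of_tendsto ((lim_slice t htm).sub (lim_slice s hsm))
      (lim_F.add ((tendsto_const_nhds.add ?_).const_mul (t - s))) (key ε hε)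
    exact tendsto_const_nhds.div_atTop
      (tendsto_atTop_add_const_right _ _ tendsto_natCast_atTop_atTop)
  have e := intervalIntegral_setIntegral_eq hst iF
  simp only [hF, setIntegral_univ] at e
  rw [e]
  have hlim : Tendsto (fun ε : ℝ => (∫ z in univ ×ˢ Ioc s t, F z) +
      (t - s) * (C * (4 * D0 * ε) + 0)) (nhdsWithin 0 (Ioi 0))
      (nhds ((∫ z in univ ×ˢ Ioc s t, F z) + (t - s) * (C * (4 * D0 * 0) + 0))) :=
    Tendsto.mono_left (Continuous.tendsto (by fun_prop) 0) nhdsWithin_le_nhds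
  have := ge_of_tendsto hlim (by
    filter_upwards [self_mem_nhdsWithin] with ε hε using lim_n ε hε)
  simpa using this

/-- The heat kernel `r^{-1/2} exp (-x² / (4 r))`, without its normalising constant. -/
def heatKernel (r x : ℝ) : ℝ := (Real.sqrt r)⁻¹ * Real.exp (-x ^ 2 / (4 * r))

theorem heatKernel_nonneg (r x : ℝ) : 0 ≤ heatKernel r x := by
  unfold heatKernel; positivity

theorem hasDerivAt_heatKernel {r : ℝ} (hr : 0 < r) (x : ℝ) :
    HasDerivAt (heatKernel r) (-(x / (2 * r)) * heatKernel r x) x := by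
  have h1 : HasDerivAt (fun x : ℝ => -x ^ 2 / (4 * r)) (-(2 * x) / (4 * r)) x := by
    simpa using ((hasDerivAt_pow 2 x).neg).div_const (4 * r)
  refine (h1.exp.const_mul (Real.sqrt r)⁻¹).congr_deriv ?_
  unfold heatKernel
  field_simp
  ring

theorem hasDerivAt_deriv_heatKernel {r : ℝ} (hr : 0 < r) (x : ℝ) :
    HasDerivAt (fun x => -(x / (2 * r)) * heatKernel r x)
      ((x ^ 2 / (4 * r ^ 2) - 1 / (2 * r)) * heatKernel r x) x := by
  refine ((((hasDerivAt_id x).div_const (2 * r)).neg).mul (hasDerivAt_heatKernel hr x)).congr_deriv ?_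
  simp only [id, Pi.neg_apply]
  field_simp
  ring

theorem hasDerivAt_heatKernel_time {r : ℝ} (hr : 0 < r) (x : ℝ) :
    HasDerivAt (fun r => heatKernel r x)
      ((x ^ 2 / (4 * r ^ 2) - 1 / (2 * r)) * heatKernel r x) r := by
  have h1 : HasDerivAt (fun r : ℝ => -x ^ 2 / (4 * r)) (x ^ 2 / (4 * r ^ 2)) r := by
    refine ((hasDerivAt_const r (-x ^ 2)).div ((hasDerivAt_id r).const_mul 4)
      (by simp; positivity)).congr_deriv ?_
    simp only [id]
    field_simp
    ring
  have h2 := (Real.hasDerivAt_sqrt hr.ne').inv (Real.sqrt_pos.2 hr).ne'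
  refine (h2.mul h1.exp).congr_deriv ?_
  have hs : 0 < Real.sqrt r := Real.sqrt_pos.2 hr
  have hsq : Real.sqrt r ^ 2 = r := Real.sq_sqrt hr.le
  unfold heatKernel
  simp only [Pi.inv_apply]
  rw [hsq]
  field_simp
  ring

theorem continuousOn_heatKernel {a b t x : ℝ} (hb : b < t) :
    ContinuousOn (fun z : ℝ × ℝ => heatKernel (t - z.2) (z.1 - x)) (univ ×ˢ Icc a b) := by
  unfold heatKernel
  have hpos : ∀ z ∈ (univ : Set ℝ) ×ˢ Icc a b, 0 < t - z.2 := fun z hz => by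
    linarith [hz.2.2]
  refine ContinuousOn.mul (ContinuousOn.inv₀ (by fun_prop) fun z hz =>
    (Real.sqrt_pos.2 (hpos z hz)).ne') ?_
  exact (ContinuousOn.div (by fun_prop) (by fun_prop) fun z hz => by
    have := hpos z hz; positivity).rexp

theorem integrable_one_add_sq_mul_gaussian {R : ℝ} (hR : 0 < R) :
    Integrable fun x : ℝ => (1 + x ^ 2) * Real.exp (-x ^ 2 / (4 * R)) := by
  have hb : 0 < 1 / (4 * R) := by positivity
  have h1 := integrable_exp_neg_mul_sq hb
  have h2 := integrable_rpow_mul_exp_neg_mul_sq hb (s := 2) (by norm_num)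
  refine (h1.add h2).congr (Eventually.of_forall fun x => ?_)
  simp only [Pi.add_apply, Real.rpow_two]
  rw [show -(1 / (4 * R)) * x ^ 2 = -x ^ 2 / (4 * R) by ring]
  ring

theorem one_add_sq_mul_gaussian_le {R : ℝ} (hR : 0 < R) (x : ℝ) :
    (1 + x ^ 2) * Real.exp (-x ^ 2 / (4 * R)) ≤ 1 + 4 * R := by
  have h1 := Real.add_one_le_exp (x ^ 2 / (4 * R))
  have h2 : Real.exp (-x ^ 2 / (4 * R)) * Real.exp (x ^ 2 / (4 * R)) = 1 := by
    rw [← Real.exp_add, neg_div, neg_add_cancel, Real.exp_zero]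
  have h3 := Real.exp_pos (-x ^ 2 / (4 * R))
  have h4 : x ^ 2 ≤ 4 * R * Real.exp (x ^ 2 / (4 * R)) := by
    have : x ^ 2 = 4 * R * (x ^ 2 / (4 * R)) := by field_simp
    nlinarith
  have h5 : Real.exp (-x ^ 2 / (4 * R)) ≤ 1 := Real.exp_le_one_iff.2 (by
    rw [neg_div]; exact neg_nonpos.2 (by positivity))
  calc (1 + x ^ 2) * Real.exp (-x ^ 2 / (4 * R))
      ≤ 1 + (4 * R * Real.exp (x ^ 2 / (4 * R))) * Real.exp (-x ^ 2 / (4 * R)) := by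
        rw [add_mul, one_mul]; gcongr
    _ = 1 + 4 * R * (Real.exp (-x ^ 2 / (4 * R)) * Real.exp (x ^ 2 / (4 * R))) := by ring
    _ = _ := by rw [h2, mul_one]

theorem heatKernel_bounds {ε R r : ℝ} (hε : 0 < ε) (hr : ε ≤ r) (hR : r ≤ R) (x : ℝ) :
    heatKernel r x ≤ (Real.sqrt ε)⁻¹ * (1 + 1 / ε + 1 / ε ^ 2) *
      ((1 + x ^ 2) * Real.exp (-x ^ 2 / (4 * R))) ∧
    |-(x / (2 * r)) * heatKernel r x| ≤ (Real.sqrt ε)⁻¹ * (1 + 1 / ε + 1 / ε ^ 2) *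
      ((1 + x ^ 2) * Real.exp (-x ^ 2 / (4 * R))) ∧
    |(x ^ 2 / (4 * r ^ 2) - 1 / (2 * r)) * heatKernel r x| ≤
      (Real.sqrt ε)⁻¹ * (1 + 1 / ε + 1 / ε ^ 2) *
      ((1 + x ^ 2) * Real.exp (-x ^ 2 / (4 * R))) := by
  have hr0 : 0 < r := hε.trans_le hr
  have hK : heatKernel r x ≤ (Real.sqrt ε)⁻¹ * Real.exp (-x ^ 2 / (4 * R)) := by
    unfold heatKernel
    have h1 : -x ^ 2 / (4 * r) ≤ -x ^ 2 / (4 * R) := by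
      rw [neg_div, neg_div]
      gcongr
    have h2 := Real.sqrt_pos.2 hε
    gcongr
  have hK0 := heatKernel_nonneg r x
  have hE : 0 ≤ (Real.sqrt ε)⁻¹ * Real.exp (-x ^ 2 / (4 * R)) := hK0.trans hK
  have key : ∀ a, |a| ≤ (1 + 1 / ε + 1 / ε ^ 2) * (1 + x ^ 2) →
      |a * heatKernel r x| ≤ (Real.sqrt ε)⁻¹ * (1 + 1 / ε + 1 / ε ^ 2) *
      ((1 + x ^ 2) * Real.exp (-x ^ 2 / (4 * R))) := fun a ha => by
    rw [abs_mul, abs_of_nonneg hK0]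
    calc |a| * heatKernel r x ≤ ((1 + 1 / ε + 1 / ε ^ 2) * (1 + x ^ 2)) *
          ((Real.sqrt ε)⁻¹ * Real.exp (-x ^ 2 / (4 * R))) :=
          mul_le_mul ha hK hK0 (by positivity)
      _ = _ := by ring
  have i1 : 1 / r ≤ 1 / ε := by gcongr
  have i2 : 1 / r ^ 2 ≤ 1 / ε ^ 2 := by gcongr
  have i3 : 0 < 1 / r := by positivity
  have i4 : 0 < 1 / r ^ 2 := by positivity
  have hx2 := sq_nonneg x
  refine ⟨?_, key _ ?_, key _ ?_⟩
  · have := key 1 (by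
      rw [abs_one]
      have : 0 ≤ 1 / ε := by positivity
      have : 0 ≤ 1 / ε ^ 2 := by positivity
      nlinarith)
    rwa [one_mul, abs_of_nonneg hK0] at this
  · rw [abs_neg, abs_div, abs_of_pos (by positivity : 0 < 2 * r)]
    have h1 : |x| ≤ 1 + x ^ 2 := by nlinarith [sq_abs x, sq_nonneg (|x| - 1)]
    calc |x| / (2 * r) = (1 / 2 * |x|) * (1 / r) := by field_simp
      _ ≤ (1 + x ^ 2) * (1 / ε) := by
          gcongr
          linarith [abs_nonneg x]
      _ ≤ _ := by
          have : 0 ≤ 1 / ε := by positivity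
          have : 0 ≤ 1 / ε ^ 2 := by positivity
          nlinarith
  · have e1 : |x ^ 2 / (4 * r ^ 2) - 1 / (2 * r)| ≤ x ^ 2 / (4 * r ^ 2) + 1 / (2 * r) := by
      refine (abs_sub _ _).trans ?_
      rw [abs_of_nonneg (by positivity), abs_of_nonneg (by positivity)]
    refine e1.trans ?_
    have e2 : x ^ 2 / (4 * r ^ 2) = x ^ 2 * (1 / r ^ 2) / 4 := by field_simp
    have e3 : 1 / (2 * r) = (1 / r) / 2 := by field_simp
    rw [e2, e3]
    have h1 : x ^ 2 * (1 / r ^ 2) ≤ x ^ 2 * (1 / ε ^ 2) := by gcongr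
    nlinarith [mul_nonneg hx2 i4.le, mul_nonneg hx2 i3.le, mul_le_mul_of_nonneg_left i1 hx2]

theorem integral_heatKernel_mul {r : ℝ} (hr : 0 < r) (x : ℝ) (f : ℝ → ℝ) :
    ∫ ξ, heatKernel r (ξ - x) * f ξ = ∫ η, Real.exp (-η ^ 2 / 4) * f (x + Real.sqrt r * η) := by
  have hs : 0 < Real.sqrt r := Real.sqrt_pos.2 hr
  have h1 := integral_sub_right_eq_self (μ := volume) (fun y => heatKernel r y * f (x + y)) x
  have h2 := Measure.integral_comp_mul_left (fun y => heatKernel r y * f (x + y)) (Real.sqrt r)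
  simp only [add_sub_cancel] at h1
  rw [h1]
  rw [abs_of_pos (inv_pos.2 hs), smul_eq_mul, inv_mul_eq_div, eq_div_iff hs.ne',
    ← integral_mul_const] at h2
  rw [← h2]
  refine integral_congr_ae (Eventually.of_forall fun η => ?_)
  simp only [heatKernel]
  rw [mul_pow, Real.sq_sqrt hr.le, show -(r * η ^ 2) / (4 * r) = -η ^ 2 / 4 by field_simp]
  field_simp

theorem integrable_gaussian_quarter : Integrable fun η : ℝ => Real.exp (-η ^ 2 / 4) := by
  refine (integrable_exp_neg_mul_sq (by norm_num : (0 : ℝ) < 1 / 4)).congr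
    (Eventually.of_forall fun x => ?_)
  simp only
  congr 1
  ring

theorem tendsto_integral_gaussian_comp {f : ℝ → ℝ} (hf : Continuous f) {M : ℝ}
    (hM : ∀ x, |f x| ≤ M) (x : ℝ) {ρ : ℝ → ℝ} {ρ₀ : ℝ} {l : Filter ℝ} [l.IsCountablyGenerated]
    (hρ : Tendsto ρ l (nhds ρ₀)) :
    Tendsto (fun ε => ∫ η, Real.exp (-η ^ 2 / 4) * f (x + ρ ε * η)) l
      (nhds (∫ η, Real.exp (-η ^ 2 / 4) * f (x + ρ₀ * η))) := by
  refine tendsto_integral_filter_of_dominated_convergence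
    (fun η => Real.exp (-η ^ 2 / 4) * M) (Eventually.of_forall fun ε => ?_)
    (Eventually.of_forall fun ε => Eventually.of_forall fun η => ?_)
    (integrable_gaussian_quarter.mul_const M) (Eventually.of_forall fun η => ?_)
  · exact Continuous.aestronglyMeasurable (by fun_prop)
  · rw [norm_mul, Real.norm_eq_abs, Real.abs_exp]
    exact mul_le_mul_of_nonneg_left (hM _) (Real.exp_pos _).le
  · refine Tendsto.const_mul _ ((hf.tendsto _).comp ?_)
    exact (hρ.mul_const η).const_add x

/-- Subsolutions lie below Gaussian averages of their earlier values, after cubing the positive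
part. -/
theorem IsHeatSubsolution.le_average {T : ℝ} {y q g : ℝ → ℝ → ℝ}
    (H : IsHeatSubsolution T y q g) {s t : ℝ} (hs : 0 ≤ s) (hst : s ≤ t) (htT : t ≤ T) (x : ℝ) :
    (∫ η : ℝ, Real.exp (-η ^ 2 / 4)) * max (y x t) 0 ^ 3 ≤
      ∫ η, Real.exp (-η ^ 2 / 4) * max (y (x + Real.sqrt (t - s) * η) s) 0 ^ 3 := by
  obtain ⟨M0, hM0⟩ := H.bound
  have hsub : Icc s t ⊆ Icc 0 T := Icc_subset_Icc hs htT
  have htm : t ∈ Icc s t := ⟨hst, le_rfl⟩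
  have hsm : s ∈ Icc s t := ⟨le_rfl, hst⟩
  have hM00 : 0 ≤ M0 := (abs_nonneg _).trans (hM0 0 t (hsub htm)).1
  have hyp : ∀ x, ∀ τ ∈ Icc s t, max (y x τ) 0 ≤ M0 := fun x τ hτ =>
    max_le ((le_abs_self _).trans (hM0 x τ (hsub hτ)).1) hM00
  have hVM : ∀ x, ∀ τ ∈ Icc s t, |max (y x τ) 0 ^ 3| ≤ M0 ^ 3 := fun x τ hτ => by
    rw [abs_of_nonneg (pow_nonneg (le_max_right _ _) 3)]
    exact pow_le_pow_left₀ (le_max_right _ _) (hyp x τ hτ) 3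
  have hrM : ∀ x, ∀ τ ∈ Icc s t, |3 * max (y x τ) 0 ^ 2 * q x τ| ≤ 3 * M0 ^ 2 * M0 :=
    fun x τ hτ => by
    rw [abs_mul, abs_of_nonneg (by positivity : 0 ≤ 3 * max (y x τ) 0 ^ 2)]
    have := pow_le_pow_left₀ (le_max_right _ _) (hyp x τ hτ) 2
    have h2 := (hM0 x τ (hsub hτ)).2
    gcongr
  have cV : ∀ τ ∈ Icc s t, Continuous fun x => max (y x τ) 0 ^ 3 := fun τ hτ => by
    have := continuous_slice H.cont (hsub hτ)
    simp only at this
    fun_prop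
  have cr : ∀ τ ∈ Icc s t, Continuous fun x => 3 * max (y x τ) 0 ^ 2 * q x τ := fun τ hτ => by
    have h1 := continuous_slice H.cont (hsub hτ)
    have h2 := continuous_slice H.cont_deriv (hsub hτ)
    simp only at h1 h2
    fun_prop
  have key : ∀ ε > 0, ∫ η, Real.exp (-η ^ 2 / 4) * max (y (x + Real.sqrt ε * η) t) 0 ^ 3 ≤
      ∫ η, Real.exp (-η ^ 2 / 4) * max (y (x + Real.sqrt (t - s + ε) * η) s) 0 ^ 3 := by
    intro ε hε
    set R := t - s + ε with hR
    have hR0 : 0 < R := by linarith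
    set c := (Real.sqrt ε)⁻¹ * (1 + 1 / ε + 1 / ε ^ 2) with hc
    have hc0 : 0 ≤ c := by positivity
    set D : ℝ → ℝ := fun ξ => c * ((1 + (ξ - x) ^ 2) * Real.exp (-(ξ - x) ^ 2 / (4 * R))) with hD
    have iD : Integrable D :=
      ((integrable_one_add_sq_mul_gaussian hR0).comp_sub_right x).const_mul c
    have hρ : ∀ τ ∈ Icc s t, 0 < t + ε - τ := fun τ hτ => by linarith [hτ.2]
    have hb : ∀ ξ, ∀ τ ∈ Icc s t, _ := fun ξ τ hτ =>
      heatKernel_bounds (R := R) hε (by linarith [hτ.2] : ε ≤ t + ε - τ)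
        (by rw [hR]; linarith [hτ.1]) (ξ - x)
    have cK : ContinuousOn (fun z : ℝ × ℝ => heatKernel (t + ε - z.2) (z.1 - x))
      (univ ×ˢ Icc s t) := continuousOn_heatKernel (by linarith)
    have hne : ∀ z ∈ (univ : Set ℝ) ×ˢ Icc s t, t + ε - z.2 ≠ 0 := fun z hz =>
      (hρ z.2 hz.2).ne'
    have hdx : ∀ ξ, ∀ τ ∈ Icc s t, HasDerivAt (fun ξ => heatKernel (t + ε - τ) (ξ - x))
        (-((ξ - x) / (2 * (t + ε - τ))) * heatKernel (t + ε - τ) (ξ - x)) ξ := fun ξ τ hτ =>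
      (hasDerivAt_heatKernel (hρ τ hτ) (ξ - x)).comp_sub_const ξ x
    have h := H.kato hs hst htT (φ := fun ξ τ => heatKernel (t + ε - τ) (ξ - x))
      (φt := fun ξ τ => -(((ξ - x) ^ 2 / (4 * (t + ε - τ) ^ 2) - 1 / (2 * (t + ε - τ))) *
        heatKernel (t + ε - τ) (ξ - x)))
      (φx := fun ξ τ => -((ξ - x) / (2 * (t + ε - τ))) * heatKernel (t + ε - τ) (ξ - x))
      (D := D) (D0 := c * (1 + 4 * R))
      (fun ξ τ hτ => by
        have h1 := (hasDerivAt_heatKernel_time (hρ τ hτ) (ξ - x)).comp τ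
          ((hasDerivAt_id τ).const_sub (t + ε))
        refine h1.congr_deriv ?_
        ring)
      hdx cK
      ((ContinuousOn.mul (ContinuousOn.sub
        (ContinuousOn.div (by fun_prop) (by fun_prop) fun z hz => by
          have := hne z hz; positivity)
        (ContinuousOn.div (by fun_prop) (by fun_prop) fun z hz => by
          have := hne z hz; positivity)) cK).neg)
      (ContinuousOn.mul (ContinuousOn.neg
        (ContinuousOn.div (by fun_prop) (by fun_prop) fun z hz => by
          have := hne z hz; positivity)) cK)
      (fun ξ τ _ => heatKernel_nonneg _ _) iD
      (fun ξ => mul_le_mul_of_nonneg_left (one_add_sq_mul_gaussian_le hR0 _) hc0)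
      (fun ξ τ hτ => (hb ξ τ hτ).1)
      (fun ξ τ hτ => by rw [abs_neg]; exact (hb ξ τ hτ).2.2)
      (fun ξ τ hτ => (hb ξ τ hτ).2.1)
    have hzero : ∀ τ ∈ uIcc s t, (∫ ξ, (-(((ξ - x) ^ 2 / (4 * (t + ε - τ) ^ 2) -
        1 / (2 * (t + ε - τ))) * heatKernel (t + ε - τ) (ξ - x)) * max (y ξ τ) 0 ^ 3 -
        -((ξ - x) / (2 * (t + ε - τ))) * heatKernel (t + ε - τ) (ξ - x) *
          (3 * max (y ξ τ) 0 ^ 2 * q ξ τ))) = 0 := by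
      intro τ hτ
      rw [uIcc_of_le hst] at hτ
      have hd1 : ∀ ξ, HasDerivAt (fun ξ => max (y ξ τ) 0 ^ 3)
          (3 * max (y ξ τ) 0 ^ 2 * q ξ τ) ξ := fun ξ => by
        refine ((hasDerivAt_max_zero_pow 1 (y ξ τ)).comp ξ
          (H.hasDerivAt τ (hsub hτ) ξ)).congr_deriv ?_
        norm_num
      have hd2 : ∀ ξ, HasDerivAt
          (fun ξ => -((ξ - x) / (2 * (t + ε - τ))) * heatKernel (t + ε - τ) (ξ - x))
          (((ξ - x) ^ 2 / (4 * (t + ε - τ) ^ 2) - 1 / (2 * (t + ε - τ))) *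
            heatKernel (t + ε - τ) (ξ - x)) ξ := fun ξ =>
        (hasDerivAt_deriv_heatKernel (hρ τ hτ) (ξ - x)).comp_sub_const ξ x
      have sK : Continuous fun ξ => heatKernel (t + ε - τ) (ξ - x) := continuous_slice cK hτ
      have sV := cV τ hτ
      have sr := cr τ hτ
      have i1 : Integrable fun ξ => (((ξ - x) ^ 2 / (4 * (t + ε - τ) ^ 2) -
          1 / (2 * (t + ε - τ))) * heatKernel (t + ε - τ) (ξ - x)) * max (y ξ τ) 0 ^ 3 := by
        refine Integrable.mono' (iD.mul_const (M0 ^ 3))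
          (Continuous.aestronglyMeasurable (by fun_prop)) (Eventually.of_forall fun ξ => ?_)
        rw [norm_mul]
        exact mul_le_mul (hb ξ τ hτ).2.2 (hVM ξ τ hτ) (abs_nonneg _) (by simp only [hD]; positivity)
      have i2 : Integrable fun ξ => (-((ξ - x) / (2 * (t + ε - τ))) *
          heatKernel (t + ε - τ) (ξ - x)) * (3 * max (y ξ τ) 0 ^ 2 * q ξ τ) := by
        refine Integrable.mono' (iD.mul_const (3 * M0 ^ 2 * M0))
          (Continuous.aestronglyMeasurable (by fun_prop)) (Eventually.of_forall fun ξ => ?_)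
        rw [norm_mul]
        exact mul_le_mul (hb ξ τ hτ).2.1 (hrM ξ τ hτ) (abs_nonneg _) (by simp only [hD]; positivity)
      have i3 : Integrable fun ξ => (-((ξ - x) / (2 * (t + ε - τ))) *
          heatKernel (t + ε - τ) (ξ - x)) * max (y ξ τ) 0 ^ 3 := by
        refine Integrable.mono' (iD.mul_const (M0 ^ 3))
          (Continuous.aestronglyMeasurable (by fun_prop)) (Eventually.of_forall fun ξ => ?_)
        rw [norm_mul]
        exact mul_le_mul (hb ξ τ hτ).2.1 (hVM ξ τ hτ) (abs_nonneg _) (by simp only [hD]; positivity)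
      have h0 := integral_eq_zero_of_hasDerivAt_of_integrable
        (fun ξ => (hd2 ξ).mul (hd1 ξ)) (i1.add i2) i3
      rw [← neg_eq_zero, ← integral_neg]
      refine Eq.trans ?_ h0
      refine integral_congr_ae (Eventually.of_forall fun ξ => ?_)
      simp only
      ring
    rw [intervalIntegral.integral_congr (g := fun _ => (0 : ℝ)) hzero,
      intervalIntegral.integral_zero] at h
    have e1 := integral_heatKernel_mul hε x fun ξ => max (y ξ t) 0 ^ 3
    have e2 := integral_heatKernel_mul hR0 x fun ξ => max (y ξ s) 0 ^ 3
    simp only [add_sub_cancel_left] at h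
    rw [show t + ε - s = R by rw [hR]; ring, e1, e2] at h
    linarith
  have hl1 := tendsto_integral_gaussian_comp (cV t htm) (fun x => hVM x t htm) x
    (ρ := fun ε => Real.sqrt ε) (l := nhdsWithin 0 (Ioi 0)) (ρ₀ := Real.sqrt 0)
    ((Real.continuous_sqrt.tendsto 0).mono_left nhdsWithin_le_nhds)
  have hl2 := tendsto_integral_gaussian_comp (cV s hsm) (fun x => hVM x s hsm) x
    (ρ := fun ε => Real.sqrt (t - s + ε)) (l := nhdsWithin 0 (Ioi 0)) (ρ₀ := Real.sqrt (t - s + 0))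
    ((Continuous.tendsto (by fun_prop) 0).mono_left nhdsWithin_le_nhds)
  have := le_of_tendsto_of_tendsto hl1 hl2 (by
    filter_upwards [self_mem_nhdsWithin] with ε hε using key ε hε)
  simpa [integral_mul_const] using this

/-- Weak maximum principle. -/
theorem IsHeatSubsolution.nonpos {T : ℝ} {y q g : ℝ → ℝ → ℝ}
    (H : IsHeatSubsolution T y q g) (h0 : ∀ x, y x 0 ≤ 0) {t : ℝ} (ht : t ∈ Icc 0 T) (x : ℝ) :
    y x t ≤ 0 := by
  have h := H.le_average le_rfl ht.1 ht.2 x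
  simp only [max_eq_right (h0 _), ne_eq, OfNat.ofNat_ne_zero, not_false_eq_true, zero_pow,
    mul_zero, integral_zero] at h
  have hA : 0 < ∫ η : ℝ, Real.exp (-η ^ 2 / 4) := integral_exp_pos integrable_gaussian_quarter
  by_contra hy
  rw [not_le] at hy
  rw [max_eq_left hy.le] at h
  have := mul_pos hA (pow_pos hy 3)
  linarith

/-- The Gaussian tail `∫_a^∞ exp (-ζ²/4) dζ`. -/
def gaussTail (a : ℝ) : ℝ := ∫ ζ in Ioi a, Real.exp (-ζ ^ 2 / 4)

theorem gaussTail_eq (a : ℝ) :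
    gaussTail a = gaussTail 0 - ∫ ζ in (0 : ℝ)..a, Real.exp (-ζ ^ 2 / 4) := by
  have := intervalIntegral.integral_interval_add_Ioi (a := (0 : ℝ)) (b := a)
    integrable_gaussian_quarter.integrableOn integrable_gaussian_quarter.integrableOn
  unfold gaussTail
  linarith

theorem hasDerivAt_gaussTail (a : ℝ) : HasDerivAt gaussTail (-Real.exp (-a ^ 2 / 4)) a := by
  have hc : Continuous fun ζ : ℝ => Real.exp (-ζ ^ 2 / 4) := by fun_prop
  have h := (hc.integral_hasStrictDerivAt 0 a).hasDerivAt.const_sub (gaussTail 0)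
  exact h.congr_of_eventuallyEq (Eventually.of_forall gaussTail_eq)

theorem continuous_gaussTail : Continuous gaussTail :=
  continuous_iff_continuousAt.2 fun a => (hasDerivAt_gaussTail a).continuousAt

theorem gaussTail_strictAnti : StrictAnti gaussTail :=
  strictAnti_of_hasDerivAt_neg hasDerivAt_gaussTail fun _ => neg_lt_zero.2 (Real.exp_pos _)

theorem gaussTail_nonneg (a : ℝ) : 0 ≤ gaussTail a :=
  setIntegral_nonneg measurableSet_Ioi fun _ _ => (Real.exp_pos _).le

theorem gaussTail_pos (a : ℝ) : 0 < gaussTail a :=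
  (gaussTail_nonneg (a + 1)).trans_lt (gaussTail_strictAnti (by linarith))

theorem gaussTail_le (a : ℝ) : gaussTail a ≤ ∫ ζ : ℝ, Real.exp (-ζ ^ 2 / 4) :=
  setIntegral_le_integral integrable_gaussian_quarter
    (Eventually.of_forall fun _ => (Real.exp_pos _).le)

theorem tendsto_gaussTail_atTop : Tendsto gaussTail atTop (nhds 0) := by
  have h := intervalIntegral_tendsto_integral_Ioi 0
    integrable_gaussian_quarter.integrableOn tendsto_id
  have h2 := h.const_sub (gaussTail 0)
  rw [show gaussTail 0 - ∫ ζ in Ioi (0:ℝ), Real.exp (-ζ ^ 2 / 4) = 0 from sub_self _] at h2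
  exact h2.congr fun a => (gaussTail_eq a).symm

/-- The prefactor `(αβ/2) exp (α²/4)` of `ψ`. -/
def psiCoeff (α β : ℝ) : ℝ := (α * β / 2) * Real.exp (α ^ 2 / 4)

theorem psiCoeff_pos {α β : ℝ} (hα : 0 < α) (hβ : 0 < β) : 0 < psiCoeff α β := by
  unfold psiCoeff; positivity

theorem psi_of_pos (α β x : ℝ) {t : ℝ} (ht : 0 < t) :
    psi α β x t = psiCoeff α β * gaussTail (max (|x| / Real.sqrt t) α) := if_pos ht

theorem psi_of_nonpos (α β x : ℝ) {t : ℝ} (ht : t ≤ 0) : psi α β x t = 0 := if_neg ht.not_gt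

theorem PsiP_eq (α β η : ℝ) : PsiP α β η = psiCoeff α β * gaussTail (max η α) := rfl

theorem psi_neg (α β x t : ℝ) : psi α β (-x) t = psi α β x t := by
  simp only [psi, abs_neg]

theorem psi_nonneg {α β : ℝ} (hα : 0 < α) (hβ : 0 < β) (x t : ℝ) : 0 ≤ psi α β x t := by
  rcases lt_or_ge 0 t with h | h
  · rw [psi_of_pos _ _ _ h]
    exact mul_nonneg (psiCoeff_pos hα hβ).le (gaussTail_nonneg _)
  · rw [psi_of_nonpos _ _ _ h]

theorem psi_le {α β : ℝ} (hα : 0 < α) (hβ : 0 < β) (x t : ℝ) :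
    psi α β x t ≤ psiCoeff α β * gaussTail α := by
  rcases lt_or_ge 0 t with h | h
  · rw [psi_of_pos _ _ _ h]
    exact mul_le_mul_of_nonneg_left (gaussTail_strictAnti.antitone (le_max_right _ _))
      (psiCoeff_pos hα hβ).le
  · rw [psi_of_nonpos _ _ _ h]
    exact mul_nonneg (psiCoeff_pos hα hβ).le (gaussTail_nonneg _)

theorem psi_le_gaussTail {α β : ℝ} (hα : 0 < α) (hβ : 0 < β) {x t r : ℝ} (hx : 0 ≤ x)
    (htr : t ≤ r) : psi α β x t ≤ psiCoeff α β * gaussTail (x / Real.sqrt r) := by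
  rcases lt_or_ge 0 t with h | h
  · rw [psi_of_pos _ _ _ h]
    refine mul_le_mul_of_nonneg_left (gaussTail_strictAnti.antitone ?_) (psiCoeff_pos hα hβ).le
    refine le_trans ?_ (le_max_left _ _)
    rw [abs_of_nonneg hx]
    have := Real.sqrt_pos.2 h
    gcongr
  · rw [psi_of_nonpos _ _ _ h]
    exact mul_nonneg (psiCoeff_pos hα hβ).le (gaussTail_nonneg _)

theorem psi_mono {α β : ℝ} (hα : 0 < α) (hβ : 0 < β) (x : ℝ) {t r : ℝ} (htr : t ≤ r) :
    psi α β x t ≤ psi α β x r := by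
  rcases lt_or_ge 0 t with h | h
  · rw [psi_of_pos _ _ _ h, psi_of_pos _ _ _ (h.trans_le htr)]
    refine mul_le_mul_of_nonneg_left (gaussTail_strictAnti.antitone ?_) (psiCoeff_pos hα hβ).le
    have := Real.sqrt_pos.2 h
    gcongr
  · rw [psi_of_nonpos _ _ _ h]
    exact psi_nonneg hα hβ _ _

theorem measurable_psi (α β : ℝ) : Measurable fun z : ℝ × ℝ => psi α β z.1 z.2 := by
  have h : (fun z : ℝ × ℝ => psi α β z.1 z.2) = fun z => if 0 < z.2 then
      psiCoeff α β * gaussTail (max (|z.1| / Real.sqrt z.2) α) else 0 := rfl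
  rw [h]
  refine Measurable.ite (measurableSet_lt measurable_const measurable_snd) ?_ measurable_const
  refine (continuous_gaussTail.measurable.comp ?_).const_mul _
  have h1 : Measurable fun z : ℝ × ℝ => |z.1| := (continuous_abs.comp continuous_fst).measurable
  have h2 : Measurable fun z : ℝ × ℝ => Real.sqrt z.2 :=
    (Real.continuous_sqrt.comp continuous_snd).measurable
  exact (h1.div h2).max measurable_const

theorem IsAdmissible.integrableOn_annulus {p : ℝ → ℝ → ℝ} (h : IsAdmissible p) {δ : ℝ}
    (hδ : 0 < δ) (R T : ℝ) :
    IntegrableOn (fun z : ℝ × ℝ => p z.1 z.2) (annulus δ R ×ˢ Icc 0 T) := by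
  have h1 : IntegrableOn (fun z : ℝ × ℝ => p z.1 z.2) (Icc δ R ×ˢ Icc 0 T) :=
    h.2.1.integrableOn_compact_subset
      (prod_mono (fun x hx => hδ.trans_le hx.1) fun t ht => ht.1) (isCompact_Icc.prod isCompact_Icc)
  have hmp : MeasurePreserving (Prod.map (fun x : ℝ => -x) (id : ℝ → ℝ)) := by
    rw [Measure.volume_eq_prod]
    exact (Measure.measurePreserving_neg volume).prod (MeasurePreserving.id volume)
  have hemb : MeasurableEmbedding (Prod.map (fun x : ℝ => -x) (id : ℝ → ℝ)) :=
    ((MeasurableEquiv.neg ℝ).measurableEmbedding).prodMap MeasurableEmbedding.id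
  have h2 := (hmp.integrableOn_comp_preimage hemb).2 h1
  have h3 : ((fun z : ℝ × ℝ => p z.1 z.2) ∘ Prod.map (fun x : ℝ => -x) (id : ℝ → ℝ)) =
      fun z => p z.1 z.2 := funext fun z => h.1 z.1 z.2
  rw [h3] at h2
  refine (h1.union h2).mono_set ?_
  rintro ⟨x, t⟩ ⟨hx, ht⟩
  rcases abs_cases x with ⟨e, _⟩ | ⟨e, _⟩
  · exact Or.inl ⟨by rw [← e]; exact ⟨hx.1, by rw [e, ← e]; exact hx.2⟩, ht⟩
  · exact Or.inr ⟨by show -x ∈ Icc δ R; rw [← e]; exact ⟨hx.1, hx.2⟩, ht⟩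

theorem measurableSet_annulus (δ R : ℝ) : MeasurableSet (annulus δ R) :=
  (isCompact_annulus δ R).measurableSet

theorem deriv_eq_zero_of_notMem_annulus {δ R : ℝ} {χ χ' : ℝ → ℝ}
    (hχ : ∀ x, HasDerivAt χ (χ' x) x) (hsupp : ∀ x, x ∉ annulus δ R → χ x = 0) {x : ℝ}
    (hx : x ∉ annulus δ R) : χ' x = 0 := by
  have hev : χ =ᶠ[nhds x] fun _ => 0 := by
    filter_upwards [(isCompact_annulus δ R).isClosed.isOpen_compl.mem_nhds hx] with z hz
    exact hsupp z hz
  exact (hχ x).unique ((hasDerivAt_const x (0:ℝ)).congr_of_eventuallyEq hev)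

theorem continuousOn_setIntegral_slice {K : Set ℝ} (hK : IsCompact K) {I : Set ℝ}
    {G : ℝ × ℝ → ℝ} (hG : ContinuousOn G (univ ×ˢ I))
    (h0 : ∀ x, x ∉ K → ∀ τ ∈ I, G (x, τ) = 0) :
    ContinuousOn (fun τ => ∫ x in K, G (x, τ)) I := by
  have h1 : ContinuousOn (fun τ => ∫ x, G (x, τ)) I := by
    refine continuousOn_integral_of_compact_support (f := fun τ x => G (x, τ)) hK ?_
      fun τ x hτ hx => h0 x hx τ hτ
    exact hG.comp (f := fun z : ℝ × ℝ => (z.2, z.1)) (by fun_prop) fun z hz => ⟨trivial, hz.1⟩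
  refine h1.congr fun τ hτ => ?_
  exact setIntegral_eq_integral_of_forall_compl_eq_zero fun x hx => h0 x hx τ hτ

theorem IsAdmissible.integrableOn_mul {α β : ℝ} {p u w : ℝ → ℝ → ℝ} (hadm : IsAdmissible p)
    (hreg : AuxReg α β u w) {C : ℝ} (hC : ∀ x t, 0 ≤ t → |u x t| ≤ C) {δ : ℝ} (hδ : 0 < δ)
    (R T : ℝ) :
    IntegrableOn (fun z : ℝ × ℝ => p z.1 z.2 * u z.1 z.2) (annulus δ R ×ˢ Icc 0 T) := by
  have hm : MeasurableSet (annulus δ R ×ˢ Icc 0 T) :=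
    (measurableSet_annulus δ R).prod measurableSet_Icc
  have hz : AEStronglyMeasurable (fun z : ℝ × ℝ => u z.1 z.2 - psi α β z.1 z.2)
      (volume.restrict (annulus δ R ×ˢ Icc 0 T)) :=
    (hreg.2.1.mono (prod_mono (subset_univ _) fun t ht => ht.1)).aestronglyMeasurable hm
  have hu : AEStronglyMeasurable (fun z : ℝ × ℝ => u z.1 z.2)
      (volume.restrict (annulus δ R ×ˢ Icc 0 T)) :=
    (hz.add (measurable_psi α β).aestronglyMeasurable).congr
      (Eventually.of_forall fun z => by simp)
  refine Integrable.mul_bdd (c := C) (hadm.integrableOn_annulus hδ R T) hu ?_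
  exact (ae_restrict_iff' hm).2 (Eventually.of_forall fun z hz => hC z.1 z.2 hz.2.1)

/-- The equation tested at a fixed time against functions supported away from `x = 0`. -/
theorem slice_identity {α β : ℝ} {p u w : ℝ → ℝ → ℝ} (hadm : IsAdmissible p)
    (hreg : AuxReg α β u w) (hweak : WeakForm α β u p w) {C : ℝ}
    (hC : ∀ x t, 0 ≤ t → |u x t| ≤ C) {δ : ℝ} (hδ : 0 < δ) {R : ℝ} {χ χ' : ℝ → ℝ}
    (hχ : ∀ x, HasDerivAt χ (χ' x) x) (hχ'c : Continuous χ')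
    (hsupp : ∀ x, x ∉ annulus δ R → χ x = 0) {t : ℝ} (ht : 0 ≤ t) :
    ∫ x in annulus δ R, χ x * (u x t - psi α β x t) =
      -∫ τ in (0:ℝ)..t, ∫ x in annulus δ R, (χ' x * w x τ + χ x * (p x τ * u x τ)) := by
  set K := annulus δ R with hK
  have hKc : IsCompact K := isCompact_annulus δ R
  have hχc : Continuous χ := continuous_iff_continuousAt.2 fun x => (hχ x).continuousAt
  have hsupp' : ∀ x, x ∉ K → χ' x = 0 := fun x hx => deriv_eq_zero_of_notMem_annulus hχ hsupp hx
  set T := t + 1 with hT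
  have hT0 : 0 < T := by linarith
  have sI : (univ : Set ℝ) ×ˢ Icc 0 T ⊆ univ ×ˢ Ici 0 := prod_mono_right fun t ht => ht.1
  have sI' : K ×ˢ Icc 0 T ⊆ univ ×ˢ Ici 0 := prod_mono (subset_univ _) fun t ht => ht.1
  have cχ : ∀ s : Set (ℝ × ℝ), ContinuousOn (fun z : ℝ × ℝ => χ z.1) s := fun s =>
    (hχc.comp continuous_fst).continuousOn
  have cχ' : ∀ s : Set (ℝ × ℝ), ContinuousOn (fun z : ℝ × ℝ => χ' z.1) s := fun s =>
    (hχ'c.comp continuous_fst).continuousOn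
  have iF : IntegrableOn (fun z : ℝ × ℝ => χ' z.1 * w z.1 z.2 + χ z.1 * (p z.1 z.2 * u z.1 z.2))
      (K ×ˢ Icc 0 T) :=
    (((cχ' _).mul (hreg.2.2.1.mono sI')).integrableOn_compact (hKc.prod isCompact_Icc)).add
      ((hadm.integrableOn_mul hreg hC hδ R T).continuousOn_mul (cχ _) (hKc.prod isCompact_Icc))
  refine eq_neg_primitive_of_weak hT0
    (Z := fun t => ∫ x in K, χ x * (u x t - psi α β x t))
    (F := fun τ => ∫ x in K, (χ' x * w x τ + χ x * (p x τ * u x τ))) ?_ ?_ ?_ t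
    ⟨ht, by linarith⟩
  · exact continuousOn_setIntegral_slice hKc
      (G := fun z => χ z.1 * (u z.1 z.2 - psi α β z.1 z.2)) ((cχ _).mul (hreg.2.1.mono sI))
      fun x hx τ _ => by simp only [hsupp x hx, zero_mul]
  · exact (integrableOn_prod_Ioc iF).integral_prod_right
  · intro θ θ' hθ hθ'c hθT
    have hθc : Continuous θ := continuous_iff_continuousAt.2 fun x => (hθ x).continuousAt
    have h := hweak T hT0 (fun x s => χ x * θ s) (fun x s => χ x * θ' s) (fun x s => χ' x * θ s)
      ⟨fun x s _ => ((hθ s).const_mul (χ x)).hasDerivWithinAt, fun x s _ => (hχ x).mul_const (θ s),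
        Continuous.continuousOn (by fun_prop), Continuous.continuousOn (by fun_prop),
        Continuous.continuousOn (by fun_prop),
        ⟨|R| + 1, fun x s _ hx => by
          show χ x * θ s = 0
          rw [hsupp x, zero_mul]
          intro h
          have := h.2
          linarith [le_abs_self R]⟩,
        fun x => by
          show χ x * θ T = 0
          rw [hθT, mul_zero]⟩
    have e1 : ∀ s, ∫ x, χ x * θ' s * (u x s - psi α β x s) =
        θ' s * ∫ x in K, χ x * (u x s - psi α β x s) := fun s => by
      rw [← integral_const_mul, setIntegral_eq_integral_of_forall_compl_eq_zero
        (fun x hx => by rw [hsupp x hx]; ring)]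
      exact integral_congr_ae (Eventually.of_forall fun x => by ring)
    have e2 : ∀ s, ∫ x, (χ' x * θ s * w x s + p x s * u x s * (χ x * θ s)) =
        θ s * ∫ x in K, (χ' x * w x s + χ x * (p x s * u x s)) := fun s => by
      rw [← integral_const_mul, setIntegral_eq_integral_of_forall_compl_eq_zero
        (fun x hx => by rw [hsupp x hx, hsupp' x hx]; ring)]
      exact integral_congr_ae (Eventually.of_forall fun x => by ring)
    simp only [e1, e2] at h
    exact h

theorem initial_value_eq_zero {α β : ℝ} {p u w : ℝ → ℝ → ℝ} (hadm : IsAdmissible p)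
    (hreg : AuxReg α β u w) (hweak : WeakForm α β u p w) {C : ℝ}
    (hC : ∀ x t, 0 ≤ t → |u x t| ≤ C) (x : ℝ) : u x 0 - psi α β x 0 = 0 := by
  set f : ℝ → ℝ := fun x => u x 0 - psi α β x 0 with hf
  have hfd : ∀ x, HasDerivAt f (w x 0) x := hreg.1 0 self_mem_Ici
  have hfc : Continuous f := continuous_iff_continuousAt.2 fun x => (hfd x).continuousAt
  have hwc : Continuous fun x => w x 0 := continuous_slice hreg.2.2.1 self_mem_Ici
  obtain ⟨χ, χ', _, hχ, hχ'c, hχ01, hχsupp, hχlim, _, _⟩ := exists_cutoff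
  have hχc : ∀ n, Continuous (χ n) := fun n =>
    continuous_iff_continuousAt.2 fun x => (hχ n x).continuousAt
  have h1 : ∀ n x, χ n x * f x * f x = 0 := by
    intro n
    obtain ⟨δ, hδ, R, hsupp⟩ := hχsupp n
    have c1 := hχc n
    have c2 := hχ'c n
    have h := slice_identity hadm hreg hweak hC hδ (R := R) (χ := fun x => χ n x * f x)
      (χ' := fun x => χ' n x * f x + χ n x * w x 0) (fun x => (hχ n x).mul (hfd x)) (by fun_prop)
      (fun x hx => by rw [(hsupp x hx).1, zero_mul]) le_rfl
    rw [intervalIntegral.integral_same, neg_zero, setIntegral_eq_integral_of_forall_compl_eq_zero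
      (fun x hx => by rw [(hsupp x hx).1]; ring)] at h
    have hcont : Continuous fun x => χ n x * f x * f x := by fun_prop
    have hcs : HasCompactSupport fun x => χ n x * f x * f x :=
      HasCompactSupport.intro (isCompact_annulus δ R) fun x hx => by rw [(hsupp x hx).1]; ring
    have h2 := (integral_eq_zero_iff_of_nonneg (fun x => by
      rw [mul_assoc]
      exact mul_nonneg (hχ01 n x).1 (mul_self_nonneg _))
      (hcont.integrable_of_hasCompactSupport hcs)).1 h
    exact congrFun ((hcont.ae_eq_iff_eq _ continuous_const).1 h2)
  have h2 : ∀ x, x ≠ 0 → f x = 0 := fun x hx => by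
    have := ((hχlim x hx).mul_const (f x)).mul_const (f x)
    simp only [h1] at this
    have := tendsto_nhds_unique this tendsto_const_nhds
    rw [one_mul] at this
    exact mul_self_eq_zero.1 this
  have hd : Dense ({0}ᶜ : Set ℝ) := dense_compl_singleton 0
  have := Continuous.ext_on hd hfc continuous_const fun x hx => h2 x hx
  exact congrFun this x

theorem spatial_deriv_zero {α β : ℝ} {u w : ℝ → ℝ → ℝ} (heven : ∀ x t, u (-x) t = u x t)
    (hreg : AuxReg α β u w) {t : ℝ} (ht : 0 ≤ t) : w 0 t = 0 := by
  have h1 := hreg.1 t ht 0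
  have h2 : HasDerivAt (fun y => u (-y) t - psi α β (-y) t) (-w 0 t) 0 := by
    have := HasDerivAt.comp (0 : ℝ) (h := fun y : ℝ => -y)
      (by simpa using h1 : HasDerivAt (fun y => u y t - psi α β y t) (w 0 t) (-0)) (hasDerivAt_neg 0)
    simpa [Function.comp_def] using this
  simp only [heven, psi_neg] at h2
  have := h1.unique h2
  linarith

theorem slice_identity_of_classical {e ex d : ℝ → ℝ → ℝ} {a b : ℝ} (hab : a ≤ b)
    (het : ∀ x, ∀ t ∈ Icc a b, HasDerivAt (fun τ => e x τ) (d x t) t)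
    (hexx : ∀ t ∈ Icc a b, ∀ x, HasDerivAt (fun ξ => ex ξ t) (d x t) x)
    (hd : ContinuousOn (fun z : ℝ × ℝ => d z.1 z.2) (univ ×ˢ Icc a b)) {δ R : ℝ} {χ χ' : ℝ → ℝ}
    (hχ : ∀ x, HasDerivAt χ (χ' x) x) (hχ'c : Continuous χ')
    (hsupp : ∀ x, x ∉ annulus δ R → χ x = 0) :
    ∫ x in annulus δ R, χ x * (e x b - e x a) =
      -∫ t in a..b, ∫ x in annulus δ R, χ' x * ex x t := by
  set K := annulus δ R with hK
  have hKc : IsCompact K := isCompact_annulus δ R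
  have hχc : Continuous χ := continuous_iff_continuousAt.2 fun x => (hχ x).continuousAt
  have hsupp' : ∀ x, x ∉ K → χ' x = 0 := fun x hx => deriv_eq_zero_of_notMem_annulus hχ hsupp hx
  have iG : IntegrableOn (fun z : ℝ × ℝ => χ z.1 * d z.1 z.2) (K ×ˢ Icc a b) :=
    ((hχc.comp continuous_fst).continuousOn.mul
      (hd.mono (prod_mono_left (subset_univ _)))).integrableOn_compact (hKc.prod isCompact_Icc)
  have h1 : ∀ x, χ x * (e x b - e x a) = ∫ t in a..b, χ x * d x t := fun x => by
    rw [intervalIntegral.integral_const_mul,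
      intervalIntegral.integral_eq_sub_of_hasDerivAt (f := fun t => e x t)]
    · rw [uIcc_of_le hab]; exact het x
    · refine ContinuousOn.intervalIntegrable ?_
      rw [uIcc_of_le hab]
      exact hd.comp (f := fun t => (x, t)) (by fun_prop) fun t ht => ⟨trivial, ht⟩
  simp only [h1]
  rw [setIntegral_intervalIntegral_eq hab iG, ← intervalIntegral_setIntegral_eq hab iG,
    ← intervalIntegral.integral_neg]
  refine intervalIntegral.integral_congr fun t ht => ?_
  rw [uIcc_of_le hab] at ht
  show ∫ x in K, χ x * d x t = -∫ x in K, χ' x * ex x t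
  have hdc : Continuous fun x => d x t := continuous_slice hd ht
  have hec : Continuous fun x => ex x t :=
    continuous_iff_continuousAt.2 fun x => (hexx t ht x).continuousAt
  have hint : ∀ f g : ℝ → ℝ, Continuous f → Continuous g → (∀ x, x ∉ K → f x = 0) →
      Integrable (f * g) := fun f g hf hg h0 =>
    (hf.mul hg).integrable_of_hasCompactSupport
      (HasCompactSupport.intro hKc fun x hx => by rw [Pi.mul_apply, h0 x hx, zero_mul])
  rw [setIntegral_eq_integral_of_forall_compl_eq_zero fun x hx => by rw [hsupp x hx, zero_mul],
    setIntegral_eq_integral_of_forall_compl_eq_zero fun x hx => by rw [hsupp' x hx, zero_mul]]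
  exact integral_mul_deriv_eq_deriv_mul_of_integrable (fun x _ => hχ x) (fun x _ => hexx t ht x)
    (hint _ _ hχc hdc hsupp) (hint _ _ hχ'c hec hsupp') (hint _ _ hχc hec hsupp)

theorem integrableOn_slice_source {α β : ℝ} {p u w : ℝ → ℝ → ℝ} (hadm : IsAdmissible p)
    (hreg : AuxReg α β u w) {C : ℝ} (hC : ∀ x t, 0 ≤ t → |u x t| ≤ C) {δ : ℝ} (hδ : 0 < δ)
    (R : ℝ) {χ χ' : ℝ → ℝ} (hχc : Continuous χ) (hχ'c : Continuous χ') {a b : ℝ} (ha : 0 ≤ a) :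
    IntegrableOn (fun z : ℝ × ℝ => χ' z.1 * w z.1 z.2 + χ z.1 * (p z.1 z.2 * u z.1 z.2))
      (annulus δ R ×ˢ Icc a b) := by
  have hKc : IsCompact (annulus δ R) := isCompact_annulus δ R
  have iF : IntegrableOn (fun z : ℝ × ℝ => χ' z.1 * w z.1 z.2 + χ z.1 * (p z.1 z.2 * u z.1 z.2))
      (annulus δ R ×ˢ Icc 0 b) :=
    (((hχ'c.comp continuous_fst).continuousOn.mul (hreg.2.2.1.mono
      (prod_mono (subset_univ _) fun t ht => ht.1))).integrableOn_compact
        (hKc.prod isCompact_Icc)).add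
      ((hadm.integrableOn_mul hreg hC hδ R b).continuousOn_mul
        (hχc.comp continuous_fst).continuousOn (hKc.prod isCompact_Icc))
  exact iF.mono_set (prod_mono_right (Icc_subset_Icc_left ha))

theorem slice_increment {α β : ℝ} {p u w : ℝ → ℝ → ℝ} (hadm : IsAdmissible p)
    (hreg : AuxReg α β u w) (hweak : WeakForm α β u p w) {C : ℝ}
    (hC : ∀ x t, 0 ≤ t → |u x t| ≤ C) {δ : ℝ} (hδ : 0 < δ) {R : ℝ} {χ χ' : ℝ → ℝ}
    (hχ : ∀ x, HasDerivAt χ (χ' x) x) (hχ'c : Continuous χ')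
    (hsupp : ∀ x, x ∉ annulus δ R → χ x = 0) {a b : ℝ} (ha : 0 ≤ a) (hab : a ≤ b) :
    (∫ x in annulus δ R, χ x * (u x b - psi α β x b)) -
        ∫ x in annulus δ R, χ x * (u x a - psi α β x a) =
      -∫ τ in a..b, ∫ x in annulus δ R, (χ' x * w x τ + χ x * (p x τ * u x τ)) := by
  have hχc : Continuous χ := continuous_iff_continuousAt.2 fun x => (hχ x).continuousAt
  have split := intervalIntegral.integral_add_adjacent_intervals
    (intervalIntegrable_setIntegral ha
      (integrableOn_slice_source hadm hreg hC hδ R hχc hχ'c le_rfl))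
    (intervalIntegrable_setIntegral hab
      (integrableOn_slice_source hadm hreg hC hδ R hχc hχ'c ha))
  rw [slice_identity hadm hreg hweak hC hδ hχ hχ'c hsupp ha,
    slice_identity hadm hreg hweak hC hδ hχ hχ'c hsupp (ha.trans hab), ← split]
  ring

theorem integrableOn_slice {α β : ℝ} {u w : ℝ → ℝ → ℝ} (hreg : AuxReg α β u w) {χ : ℝ → ℝ}
    (hχc : Continuous χ) (δ R : ℝ) {t : ℝ} (ht : 0 ≤ t) :
    IntegrableOn (fun x => χ x * (u x t - psi α β x t)) (annulus δ R) :=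
  ((hχc.mul (continuous_slice hreg.2.1 ht)).continuousOn).integrableOn_compact
    (isCompact_annulus δ R)

/-- A nonnegative classical solution `e` of the heat equation bounds `ψ - u` from above as soon as
`u ≤ 0` wherever the bound fails. -/
theorem psi_sub_le_of_classical {α β : ℝ} {p u w : ℝ → ℝ → ℝ} (hadm : IsAdmissible p)
    (hnn : ∀ x t, 0 ≤ p x t) (heven : ∀ x t, u (-x) t = u x t)
    (hreg : AuxReg α β u w) (hweak : WeakForm α β u p w) {C : ℝ}
    (hC : ∀ x t, 0 ≤ t → |u x t| ≤ C) {T : ℝ} (hT : 0 < T) {e ex d : ℝ → ℝ → ℝ}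
    (het : ∀ x, ∀ t ∈ Icc 0 T, HasDerivAt (fun τ => e x τ) (d x t) t)
    (hex : ∀ t ∈ Icc 0 T, ∀ x, HasDerivAt (fun ξ => e ξ t) (ex x t) x)
    (hexx : ∀ t ∈ Icc 0 T, ∀ x, HasDerivAt (fun ξ => ex ξ t) (d x t) x)
    (he : ContinuousOn (fun z : ℝ × ℝ => e z.1 z.2) (univ ×ˢ Icc 0 T))
    (hexc : ContinuousOn (fun z : ℝ × ℝ => ex z.1 z.2) (univ ×ˢ Icc 0 T))
    (hd : ContinuousOn (fun z : ℝ × ℝ => d z.1 z.2) (univ ×ˢ Icc 0 T))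
    (hbd : ∃ B, ∀ x, ∀ t ∈ Icc 0 T, |e x t| ≤ B ∧ |ex x t| ≤ B)
    (h0 : ∀ x, 0 ≤ e x 0)
    (hneu : ∀ t ∈ Icc 0 T, 0 < psi α β 0 t - u 0 t - e 0 t → ex 0 t = 0)
    (hsrc : ∀ x, ∀ t ∈ Icc 0 T, 0 < psi α β x t - u x t - e x t → u x t ≤ 0)
    {t : ℝ} (ht : t ∈ Icc 0 T) (x : ℝ) : psi α β x t - u x t ≤ e x t := by
  have sI : (univ : Set ℝ) ×ˢ Icc 0 T ⊆ univ ×ˢ Ici 0 := prod_mono_right fun t ht => ht.1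
  have H : IsHeatSubsolution T (fun x t => psi α β x t - u x t - e x t)
      (fun x t => -w x t - ex x t) (fun x t => -(p x t * u x t)) := by
    refine ⟨fun t ht x => ?_, ?_, ?_, ?_, ?_, ?_, ?_, ?_⟩
    · have := (hreg.1 t ht.1 x).neg.sub (hex t ht x)
      exact this.congr_of_eventuallyEq (Eventually.of_forall fun y => by simp)
    · have := ((hreg.2.1.mono sI).neg).sub he
      exact this.congr fun z _ => by simp
    · exact ((hreg.2.2.1.mono sI).neg).sub hexc
    · obtain ⟨B, hB⟩ := hbd
      obtain ⟨B', hB'⟩ := hreg.2.2.2 T hT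
      refine ⟨B' + B, fun x t ht => ?_⟩
      have h1 := hB x t ht
      have h2 := hB' x t ht
      simp only [abs_le] at *
      constructor <;> constructor <;> linarith [h1.1.1, h1.1.2, h1.2.1, h1.2.2, h2.1.1, h2.1.2,
        h2.2.1, h2.2.2]
    · intro t ht h
      rw [spatial_deriv_zero heven hreg ht.1, hneu t ht h]
      simp
    · intro δ hδ R
      exact (hadm.integrableOn_mul hreg hC hδ R T).neg
    · intro x t ht h
      have := hsrc x t ht h
      nlinarith [hnn x t]
    · intro δ hδ R χ χ' hχ hχ'c _ hsupp a b ha hab hbT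
      set K := annulus δ R
      have hKc : IsCompact K := isCompact_annulus δ R
      have hχc : Continuous χ := continuous_iff_continuousAt.2 fun x => (hχ x).continuousAt
      have hb := ha.trans hab
      have sab : Icc a b ⊆ Icc 0 T := Icc_subset_Icc ha hbT
      have sK : ∀ {c d : ℝ}, 0 ≤ c → K ×ˢ Icc c d ⊆ univ ×ˢ Ici 0 := fun hc =>
        prod_mono (subset_univ _) fun t ht => hc.trans ht.1
      have inc := slice_increment hadm hreg hweak hC hδ hχ hχ'c hsupp ha hab
      have ie := slice_identity_of_classical hab (fun x t ht => het x t (sab ht))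
        (fun t ht => hexx t (sab ht)) (hd.mono (prod_mono_right sab)) hχ hχ'c hsupp
      have iF := integrableOn_slice_source (a := a) (b := b) hadm hreg hC hδ R hχc hχ'c ha
      have iE : IntegrableOn (fun z : ℝ × ℝ => χ' z.1 * ex z.1 z.2) (K ×ˢ Icc a b) :=
        ((hχ'c.comp continuous_fst).continuousOn.mul
          (hexc.mono (prod_mono (subset_univ _) sab))).integrableOn_compact
          (hKc.prod isCompact_Icc)
      have hel : ∀ t ∈ Icc a b, Continuous fun x => e x t := fun t ht =>
        continuous_slice he (sab ht)
      have iSe : IntegrableOn (fun x => χ x * (e x b - e x a)) K :=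
        ((hχc.mul ((hel b ⟨hab, le_rfl⟩).sub (hel a ⟨le_rfl, hab⟩))).continuousOn
          ).integrableOn_compact hKc
      have eL : ∫ x in K, χ x * ((psi α β x b - u x b - e x b) - (psi α β x a - u x a - e x a)) =
          (∫ x in K, χ x * (u x a - psi α β x a)) - (∫ x in K, χ x * (u x b - psi α β x b)) -
            ∫ x in K, χ x * (e x b - e x a) := by
        have ia := integrableOn_slice hreg hχc δ R ha
        have ib := integrableOn_slice hreg hχc δ R hb
        have iab : IntegrableOn (fun x => χ x * (u x a - psi α β x a) -
            χ x * (u x b - psi α β x b)) K := ia.sub ib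
        rw [← integral_sub ia ib, ← integral_sub iab iSe]
        exact integral_congr_ae (Eventually.of_forall fun x => by ring)
      have eR : ∫ t in a..b, ∫ x in K, (χ' x * (-w x t - ex x t) + χ x * -(p x t * u x t)) =
          -(∫ t in a..b, ∫ x in K, (χ' x * w x t + χ x * (p x t * u x t))) -
            ∫ t in a..b, ∫ x in K, χ' x * ex x t := by
        have iN : IntegrableOn (fun z : ℝ × ℝ => χ' z.1 * (-w z.1 z.2 - ex z.1 z.2) +
          χ z.1 * -(p z.1 z.2 * u z.1 z.2)) (K ×ˢ Icc a b) :=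
          (iF.neg.sub iE).congr (Eventually.of_forall fun z => by
            simp only [Pi.sub_apply, Pi.neg_apply]; ring)
        have sI : K ×ˢ Ioc a b ⊆ K ×ˢ Icc a b := prod_mono_right Ioc_subset_Icc_self
        have iFm : IntegrableOn (fun z : ℝ × ℝ => -(χ' z.1 * w z.1 z.2 +
            χ z.1 * (p z.1 z.2 * u z.1 z.2))) (K ×ˢ Ioc a b) := (iF.mono_set sI).neg
        rw [intervalIntegral_setIntegral_eq hab iN, intervalIntegral_setIntegral_eq hab iF,
          intervalIntegral_setIntegral_eq hab iE, ← integral_neg,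
          ← integral_sub iFm (iE.mono_set sI)]
        exact integral_congr_ae (Eventually.of_forall fun z => by ring)
      show (∫ x in K, χ x * ((psi α β x b - u x b - e x b) - (psi α β x a - u x a - e x a))) ≤ _
      rw [eL, eR, ie]
      linarith
  have := H.nonpos (fun x => ?_) ht x
  · show psi α β x t - u x t ≤ e x t
    linarith
  · have h1 := initial_value_eq_zero hadm hreg hweak hC x
    linarith [h0 x]

theorem nonneg_of_weak {α β : ℝ} (hα : 0 < α) (hβ : 0 < β) {p u w : ℝ → ℝ → ℝ}
    (hadm : IsAdmissible p) (hnn : ∀ x t, 0 ≤ p x t) (heven : ∀ x t, u (-x) t = u x t)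
    (hreg : AuxReg α β u w) (hweak : WeakForm α β u p w) {C : ℝ}
    (hC : ∀ x t, 0 ≤ t → |u x t| ≤ C) (x : ℝ) {t : ℝ} (ht : 0 ≤ t) : 0 ≤ u x t := by
  have hc := psiCoeff_pos hα hβ
  set c := psiCoeff α β with hcdef
  have hK : ∀ x t, 0 ≤ t → psi α β x t - u x t ≤ c * gaussTail α := by
    intro x t ht
    refine psi_sub_le_of_classical hadm hnn heven hreg hweak hC (T := t + 1) (by linarith)
      (e := fun _ _ => c * gaussTail α) (ex := fun _ _ => 0) (d := fun _ _ => 0)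
      (fun x t _ => hasDerivAt_const t _) (fun t _ x => hasDerivAt_const x _)
      (fun t _ x => hasDerivAt_const x _) continuousOn_const continuousOn_const continuousOn_const
      ⟨|c * gaussTail α|, fun x t _ => ⟨le_rfl, abs_zero.trans_le (abs_nonneg _)⟩⟩
      (fun x => mul_nonneg hc.le (gaussTail_nonneg α)) (fun _ _ _ => rfl) ?_
      ⟨ht, by linarith⟩ x
    intro x t _ h
    have := psi_le hα hβ x t
    linarith
  have hε : ∀ ε > 0, ∀ x t, 0 ≤ t →
      psi α β x t - u x t ≤ c * gaussTail (x / Real.sqrt (t + ε)) := by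
    intro ε hε x t ht
    set E : ℝ → ℝ → ℝ := fun x t => Real.exp (-(x / Real.sqrt (t + ε)) ^ 2 / 4) with hE
    have hs : ∀ {T : ℝ}, ∀ t ∈ Icc 0 T, 0 < Real.sqrt (t + ε) := fun t ht =>
      Real.sqrt_pos.2 (by linarith [ht.1])
    have hEx : ∀ {T : ℝ}, ∀ t ∈ Icc 0 T, ∀ x, HasDerivAt (fun ξ => E ξ t)
        (-(E x t * x / (2 * Real.sqrt (t + ε) ^ 2))) x := by
      intro T t ht x
      have h0 := (hs t ht).ne'
      have h1 := ((((hasDerivAt_id x).div_const (Real.sqrt (t + ε))).pow 2).neg.div_const 4).exp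
      refine h1.congr_deriv ?_
      simp only [hE, id, Pi.neg_apply, Pi.pow_apply, Nat.add_one_sub_one, pow_one, Nat.cast_ofNat]
      generalize Real.sqrt (t + ε) = r at h0 ⊢
      field_simp
      ring
    have hsc : ContinuousOn (fun z : ℝ × ℝ => Real.sqrt (z.2 + ε)) (univ ×ˢ Icc 0 (t + 1)) := by
      fun_prop
    have hs0 : ∀ z ∈ (univ : Set ℝ) ×ˢ Icc 0 (t + 1), Real.sqrt (z.2 + ε) ≠ 0 := fun z hz =>
      (hs z.2 hz.2).ne'
    have hac : ContinuousOn (fun z : ℝ × ℝ => z.1 / Real.sqrt (z.2 + ε))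
      (univ ×ˢ Icc 0 (t + 1)) := continuousOn_fst.div hsc hs0
    have hEc : ContinuousOn (fun z : ℝ × ℝ => E z.1 z.2) (univ ×ˢ Icc 0 (t + 1)) :=
      (((hac.pow 2).neg).div_const 4).rexp
    refine psi_sub_le_of_classical hadm hnn heven hreg hweak hC (T := t + 1) (by linarith)
      (e := fun x t => c * gaussTail (x / Real.sqrt (t + ε)))
      (ex := fun x t => -(c * (E x t / Real.sqrt (t + ε))))
      (d := fun x t => c * (E x t * x / (2 * Real.sqrt (t + ε) ^ 3))) ?_ ?_ ?_ ?_ ?_ ?_ ?_ ?_ ?_ ?_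
      ⟨ht, by linarith⟩ x
    · intro x t ht
      have h0 := hs t ht
      have h1 : HasDerivAt (fun τ => Real.sqrt (τ + ε)) (1 / (2 * Real.sqrt (t + ε))) t :=
        ((hasDerivAt_id t).add_const ε).sqrt (by simp only [id]; linarith [ht.1])
      have h2 : HasDerivAt (fun τ => x / Real.sqrt (τ + ε))
          (-(x / (2 * Real.sqrt (t + ε) ^ 3))) t := by
        refine ((hasDerivAt_const t x).div h1 h0.ne').congr_deriv ?_
        field_simp
        ring
      refine (((hasDerivAt_gaussTail _).comp t h2).const_mul c).congr_deriv ?_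
      simp only [hE]
      ring
    · intro t ht x
      have h0 := hs t ht
      have h1 := ((hasDerivAt_gaussTail (x / Real.sqrt (t + ε))).comp x
        ((hasDerivAt_id x).div_const (Real.sqrt (t + ε)))).const_mul c
      refine h1.congr_deriv ?_
      simp only [hE]
      ring
    · intro t ht x
      have h0 := hs t ht
      refine (((hEx t ht x).div_const (Real.sqrt (t + ε))).const_mul c).neg.congr_deriv ?_
      field_simp
    · exact (continuous_gaussTail.comp_continuousOn hac).const_mul c
    · exact ((hEc.div hsc hs0).const_mul c).neg
    · exact ((hEc.mul continuousOn_fst).div ((hsc.pow 3).const_mul 2) fun z hz =>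
        mul_ne_zero two_ne_zero (pow_ne_zero 3 (hs0 z hz))).const_mul c
    · refine ⟨max (c * ∫ ζ : ℝ, Real.exp (-ζ ^ 2 / 4)) (c * (1 / Real.sqrt ε)),
        fun x t ht => ⟨?_, ?_⟩⟩
      · refine le_trans ?_ (le_max_left _ _)
        rw [abs_of_nonneg (mul_nonneg hc.le (gaussTail_nonneg _))]
        exact mul_le_mul_of_nonneg_left (gaussTail_le _) hc.le
      · refine le_trans ?_ (le_max_right _ _)
        have h0 := hs t ht
        have h1 : 0 ≤ E x t := (Real.exp_pos _).le
        have h2 : E x t ≤ 1 := Real.exp_le_one_iff.2 (by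
          have := sq_nonneg (x / Real.sqrt (t + ε)); linarith)
        have h3 : Real.sqrt ε ≤ Real.sqrt (t + ε) := Real.sqrt_le_sqrt (by linarith [ht.1])
        have h4 := Real.sqrt_pos.2 hε
        rw [abs_neg, abs_of_nonneg (by positivity)]
        gcongr
    · intro x
      exact mul_nonneg hc.le (gaussTail_nonneg _)
    · intro t ht h
      have h1 := hK 0 t ht.1
      rw [zero_div] at h
      have := mul_lt_mul_of_pos_left (gaussTail_strictAnti hα) hc
      linarith
    · intro x t ht h
      rcases le_or_gt 0 x with hx | hx
      · have := psi_le_gaussTail hα hβ hx (show t ≤ t + ε by linarith)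
        linarith
      · have h1 := hK x t ht.1
        have h2 : x / Real.sqrt (t + ε) < α :=
          (div_neg_of_neg_of_pos hx (hs t ht)).trans hα
        have := mul_lt_mul_of_pos_left (gaussTail_strictAnti h2) hc
        linarith
  have hpos : ∀ x, 0 ≤ x → 0 ≤ u x t := by
    intro x hx
    rcases ht.eq_or_lt with rfl | ht'
    · have := initial_value_eq_zero hadm hreg hweak hC x
      rw [psi_of_nonpos _ _ _ le_rfl] at this
      linarith
    · have h1 : psi α β x t - u x t ≤ c * gaussTail (x / Real.sqrt t) := by
        have hsq := Real.sqrt_pos.2 ht'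
        have hcont : Tendsto (fun ε : ℝ => c * gaussTail (x / Real.sqrt (t + ε)))
            (nhdsWithin 0 (Ioi 0)) (nhds (c * gaussTail (x / Real.sqrt (t + 0)))) := by
          refine Tendsto.mono_left ?_ nhdsWithin_le_nhds
          refine ((continuous_gaussTail.continuousAt.comp ?_).const_mul c)
          refine ContinuousAt.div continuousAt_const (by fun_prop) ?_
          rw [add_zero]; exact hsq.ne'
        rw [add_zero] at hcont
        exact ge_of_tendsto hcont (eventually_mem_nhdsWithin.mono fun ε hε' => hε ε hε' x t ht)
      have h2 := hK x t ht
      rw [psi_of_pos _ _ _ ht', abs_of_nonneg hx] at h1 h2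
      rcases le_total (x / Real.sqrt t) α with h | h
      · rw [max_eq_right h] at h2; linarith
      · rw [max_eq_left h] at h1; linarith
  rcases le_total 0 x with hx | hx
  · exact hpos x hx
  · rw [← heven]; exact hpos (-x) (by linarith)

theorem IntegrableOn.comp_time_shift {K : Set ℝ} {f : ℝ × ℝ → ℝ} {T h : ℝ} (hh : 0 ≤ h)
    (hf : IntegrableOn f (K ×ˢ Icc 0 (T + h))) :
    IntegrableOn (fun z : ℝ × ℝ => f (z.1, z.2 + h)) (K ×ˢ Icc 0 T) := by
  have hmp : MeasurePreserving (Prod.map (id : ℝ → ℝ) (fun t : ℝ => t + h)) :=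
    (MeasurePreserving.id volume).prod (measurePreserving_add_right volume h)
  have hme : MeasurableEmbedding (Prod.map (id : ℝ → ℝ) (fun t : ℝ => t + h)) :=
    MeasurableEmbedding.id.prodMap (measurableEmbedding_addRight h)
  have := (hmp.integrableOn_comp_preimage hme).2 hf
  refine this.mono_set fun z hz => ⟨hz.1, ?_, ?_⟩
  · exact add_nonneg hz.2.1 hh
  · exact add_le_add_left hz.2.2 h

theorem isHeatSubsolution_time_diff {α β : ℝ} (hα : 0 < α) (hβ : 0 < β) {p u w : ℝ → ℝ → ℝ}
    (hadm : IsAdmissible p) (hnn : ∀ x t, 0 ≤ p x t)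
    (hmono : ∀ x, MonotoneOn (fun t => p x t) (Ici (0:ℝ))) (heven : ∀ x t, u (-x) t = u x t)
    (hreg : AuxReg α β u w) (hweak : WeakForm α β u p w) {C : ℝ}
    (hC : ∀ x t, 0 ≤ t → |u x t| ≤ C) {h : ℝ} (hh : 0 ≤ h) {T : ℝ} (hT : 0 < T) :
    IsHeatSubsolution T
      (fun x t => (u x (t + h) - psi α β x (t + h)) - (u x t - psi α β x t))
      (fun x t => w x (t + h) - w x t)
      (fun x t => p x (t + h) * u x (t + h) - p x t * u x t) := by
  have sI : (univ : Set ℝ) ×ˢ Icc 0 T ⊆ univ ×ˢ Ici 0 := prod_mono_right fun t ht => ht.1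
  have mI : MapsTo (fun z : ℝ × ℝ => (z.1, z.2 + h)) (univ ×ˢ Icc 0 T) (univ ×ˢ Ici 0) :=
    fun z hz => ⟨trivial, add_nonneg hz.2.1 hh⟩
  refine ⟨fun t ht x => ?_, ?_, ?_, ?_, ?_, ?_, ?_, ?_⟩
  · exact (hreg.1 (t + h) (add_nonneg ht.1 hh) x).sub (hreg.1 t ht.1 x)
  · exact (hreg.2.1.comp (by fun_prop) mI).sub (hreg.2.1.mono sI)
  · exact (hreg.2.2.1.comp (by fun_prop) mI).sub (hreg.2.2.1.mono sI)
  · obtain ⟨B, hB⟩ := hreg.2.2.2 (T + h) (by linarith)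
    refine ⟨B + B, fun x t ht => ?_⟩
    have h1 := hB x t ⟨ht.1, by linarith [ht.2]⟩
    have h2 := hB x (t + h) ⟨add_nonneg ht.1 hh, by linarith [ht.2]⟩
    exact ⟨(abs_sub _ _).trans (add_le_add h2.1 h1.1), (abs_sub _ _).trans (add_le_add h2.2 h1.2)⟩
  · intro t ht _
    rw [spatial_deriv_zero heven hreg ht.1, spatial_deriv_zero heven hreg (add_nonneg ht.1 hh),
      sub_zero]
  · intro δ hδ R
    exact (IntegrableOn.comp_time_shift hh (hadm.integrableOn_mul hreg hC hδ R (T + h))).sub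
      (hadm.integrableOn_mul hreg hC hδ R T)
  · intro x t ht hy
    have h1 := psi_mono hα hβ x (show t ≤ t + h by linarith)
    have h2 := nonneg_of_weak hα hβ hadm hnn heven hreg hweak hC x ht.1
    have h3 := hmono x ht.1 (show t + h ∈ Ici (0:ℝ) from add_nonneg ht.1 hh)
      (show t ≤ t + h by linarith)
    have h4 : u x t ≤ u x (t + h) := by linarith
    exact sub_nonneg.2 (mul_le_mul h3 h4 h2 (hnn x _))
  · intro δ hδ R χ χ' hχ hχ'c _ hsupp a b ha hab hbT
    set K := annulus δ R
    have hχc : Continuous χ := continuous_iff_continuousAt.2 fun x => (hχ x).continuousAt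
    have hb := ha.trans hab
    have inc := slice_increment hadm hreg hweak hC hδ hχ hχ'c hsupp ha hab
    have inc' := slice_increment hadm hreg hweak hC hδ hχ hχ'c hsupp (add_nonneg ha hh)
      (add_le_add_left hab h)
    have iF := integrableOn_slice_source (a := 0) (b := b) hadm hreg hC hδ R hχc hχ'c le_rfl
    have iF' := integrableOn_slice_source (a := 0) (b := b + h) hadm hreg hC hδ R hχc hχ'c le_rfl
    have iS := IntegrableOn.comp_time_shift hh iF'
    have iFab := iF.mono_set (prod_mono_right (Icc_subset_Icc_left (b := b) ha))
    have iSab := iS.mono_set (prod_mono_right (Icc_subset_Icc_left (b := b) ha))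
    have i1 := integrableOn_slice hreg hχc δ R ha
    have i2 := integrableOn_slice hreg hχc δ R hb
    have i3 := integrableOn_slice hreg hχc δ R (add_nonneg ha hh)
    have i4 := integrableOn_slice hreg hχc δ R (add_nonneg hb hh)
    have i43 : IntegrableOn (fun x => χ x * (u x (b + h) - psi α β x (b + h)) -
      χ x * (u x (a + h) - psi α β x (a + h))) K := i4.sub i3
    have i21 : IntegrableOn (fun x => χ x * (u x b - psi α β x b) -
      χ x * (u x a - psi α β x a)) K := i2.sub i1
    rw [← integral_sub i2 i1] at inc
    rw [← integral_sub i4 i3, ← intervalIntegral.integral_comp_add_right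
      (fun τ => ∫ x in annulus δ R, (χ' x * w x τ + χ x * (p x τ * u x τ))) h] at inc'
    have eR : ∫ t in a..b, ∫ x in K, (χ' x * (w x (t + h) - w x t) +
          χ x * (p x (t + h) * u x (t + h) - p x t * u x t)) =
        (∫ t in a..b, ∫ x in K, (χ' x * w x (t + h) + χ x * (p x (t + h) * u x (t + h)))) -
          ∫ t in a..b, ∫ x in K, (χ' x * w x t + χ x * (p x t * u x t)) := by
      have sI : K ×ˢ Ioc a b ⊆ K ×ˢ Icc a b := prod_mono_right Ioc_subset_Icc_self
      have iN : IntegrableOn (fun z : ℝ × ℝ => χ' z.1 * (w z.1 (z.2 + h) - w z.1 z.2) +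
          χ z.1 * (p z.1 (z.2 + h) * u z.1 (z.2 + h) - p z.1 z.2 * u z.1 z.2)) (K ×ˢ Icc a b) :=
        (iSab.sub iFab).congr (Eventually.of_forall fun z => by simp only [Pi.sub_apply]; ring)
      rw [intervalIntegral_setIntegral_eq hab iN, intervalIntegral_setIntegral_eq hab iFab,
        intervalIntegral_setIntegral_eq hab iSab, ← integral_sub (iSab.mono_set sI)
          (iFab.mono_set sI)]
      exact integral_congr_ae (Eventually.of_forall fun z => by ring)
    have eL : ∫ x in K, χ x * ((u x (b + h) - psi α β x (b + h) - (u x b - psi α β x b)) -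
          (u x (a + h) - psi α β x (a + h) - (u x a - psi α β x a))) =
        (∫ x in K, (χ x * (u x (b + h) - psi α β x (b + h)) -
          χ x * (u x (a + h) - psi α β x (a + h)))) -
        ∫ x in K, (χ x * (u x b - psi α β x b) - χ x * (u x a - psi α β x a)) := by
      rw [← integral_sub i43 i21]
      exact integral_congr_ae (Eventually.of_forall fun x => by ring)
    show (∫ x in K, χ x * ((u x (b + h) - psi α β x (b + h) - (u x b - psi α β x b)) -
          (u x (a + h) - psi α β x (a + h) - (u x a - psi α β x a)))) ≤ _
    rw [eL, eR, inc, inc']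
    linarith

theorem sub_le_mul_cube_sub {ε B m Y : ℝ} (hε : 0 < ε) (hm : ε ≤ m) (hmB : m ≤ 2 * B)
    (hYm : Y ≤ m) (hYB : -(2 * B) ≤ Y) :
    m - Y ≤ (ε + 4 * B) / ε ^ 3 * (m ^ 3 - max Y 0 ^ 3) := by
  have hm0 : 0 < m := hε.trans_le hm
  have hB : 0 ≤ B := by linarith
  rw [div_mul_eq_mul_div, le_div_iff₀ (by positivity)]
  rcases le_total 0 Y with h | h
  · rw [max_eq_left h]
    have h1 : ε ^ 2 ≤ m ^ 2 + m * Y + Y ^ 2 := by nlinarith [mul_nonneg hm0.le h]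
    have h2 : (m - Y) * ε ^ 2 ≤ m ^ 3 - Y ^ 3 := by
      have := mul_le_mul_of_nonneg_left h1 (sub_nonneg.2 hYm)
      linarith
    have h3 : 0 ≤ m ^ 3 - Y ^ 3 := le_trans (mul_nonneg (by linarith) (by positivity)) h2
    nlinarith [mul_nonneg hB h3]
  · rw [max_eq_right h]
    have h1 : ε ^ 3 ≤ m ^ 3 := by gcongr
    have h2 : 0 < ε ^ 3 := by positivity
    have h3 : (m - Y) * ε ^ 3 ≤ (4 * B) * m ^ 3 :=
      mul_le_mul (by linarith) h1 h2.le (by linarith)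
    have h4 := mul_pos hε (pow_pos hm0 3)
    linarith

/-- A nearly maximal Gaussian average controls the defect on a fixed interval. -/
theorem integral_defect_le {V : ℝ → ℝ} (hV : Continuous V) {M D h x : ℝ} (hV0 : ∀ ξ, 0 ≤ V ξ)
    (hVM : ∀ ξ, V ξ ≤ M) {i N : ℕ} (hi : 1 ≤ i) (hiN : i ≤ N)
    (hD : (∫ η : ℝ, Real.exp (-η ^ 2 / 4)) * M -
      ∫ η, Real.exp (-η ^ 2 / 4) * V (x + Real.sqrt (i * h) * η) ≤ D) :
    ∫ ζ in (-1:ℝ)..1, (M - V (x + Real.sqrt h * ζ)) ≤ Real.sqrt N * Real.exp (1 / 4) * D := by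
  have hi0 : (0:ℝ) < Real.sqrt i := Real.sqrt_pos.2 (by exact_mod_cast hi)
  have hi1 : (1:ℝ) ≤ i := by exact_mod_cast hi
  set g : ℝ → ℝ := fun ζ => Real.exp (-(ζ / Real.sqrt i) ^ 2 / 4) * (M - V (x + Real.sqrt h * ζ))
    with hg
  have hgc : Continuous g := by fun_prop
  have hg0 : ∀ ζ, 0 ≤ g ζ := fun ζ => mul_nonneg (Real.exp_pos _).le (sub_nonneg.2 (hVM _))
  have hVi : Integrable fun η => Real.exp (-η ^ 2 / 4) * V (x + Real.sqrt (i * h) * η) :=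
    integrable_gaussian_quarter.mul_bdd (c := M)
      (Continuous.aestronglyMeasurable (by fun_prop))
      (Eventually.of_forall fun η => by
        rw [Real.norm_eq_abs, abs_of_nonneg (hV0 _)]; exact hVM _)
  have hcomp : ∀ η, g (Real.sqrt i * η) =
      Real.exp (-η ^ 2 / 4) * M - Real.exp (-η ^ 2 / 4) * V (x + Real.sqrt (i * h) * η) := by
    intro η
    rw [Real.sqrt_mul (by positivity), hg]
    simp only [mul_div_cancel_left₀ η hi0.ne']
    rw [← mul_sub, ← mul_assoc, mul_comm (Real.sqrt i)]
  have hgi : Integrable fun η => g (Real.sqrt i * η) := by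
    simp only [hcomp]
    exact (integrable_gaussian_quarter.mul_const M).sub hVi
  have hgint : Integrable g := (integrable_comp_mul_left_iff g hi0.ne').1 hgi
  have h1 : ∫ η, g (Real.sqrt i * η) ≤ D := by
    simp only [hcomp]
    rw [integral_sub (integrable_gaussian_quarter.mul_const M) hVi, integral_mul_const]
    exact hD
  rw [Measure.integral_comp_mul_left, abs_of_nonneg (inv_nonneg.2 hi0.le), smul_eq_mul,
    inv_mul_le_iff₀ hi0] at h1
  have hD0 : 0 ≤ D := by
    have := integral_nonneg (μ := volume) (f := g) hg0
    by_contra hneg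
    have := mul_neg_of_pos_of_neg hi0 (not_le.1 hneg)
    linarith
  have h2 : ∫ ζ in (-1:ℝ)..1, g ζ ≤ ∫ ζ, g ζ := by
    rw [intervalIntegral.integral_of_le (by norm_num)]
    exact setIntegral_le_integral hgint (Eventually.of_forall hg0)
  have h3 : ∫ ζ in (-1:ℝ)..1, (M - V (x + Real.sqrt h * ζ)) ≤
      ∫ ζ in (-1:ℝ)..1, Real.exp (1 / 4) * g ζ := by
    refine intervalIntegral.integral_mono_on (by norm_num)
      (Continuous.intervalIntegrable (by fun_prop) _ _)
      (Continuous.intervalIntegrable (by fun_prop) _ _) fun ζ hζ => ?_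
    rw [hg]
    simp only
    rw [← mul_assoc, ← Real.exp_add]
    refine le_mul_of_one_le_left (sub_nonneg.2 (hVM _)) (Real.one_le_exp ?_)
    rw [div_pow, Real.sq_sqrt (by positivity)]
    have h4 : ζ ^ 2 ≤ 1 := by nlinarith [hζ.1, hζ.2]
    have h5 : ζ ^ 2 / i ≤ 1 := by
      rw [div_le_one (by positivity)]; linarith
    linarith
  rw [intervalIntegral.integral_const_mul] at h3
  have h6 : Real.sqrt i ≤ Real.sqrt N := Real.sqrt_le_sqrt (by exact_mod_cast hiN)
  calc _ ≤ Real.exp (1 / 4) * ∫ ζ in (-1:ℝ)..1, g ζ := h3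
    _ ≤ Real.exp (1 / 4) * (Real.sqrt N * D) := by
        refine mul_le_mul_of_nonneg_left ?_ (Real.exp_pos _).le
        exact h2.trans (h1.trans (mul_le_mul_of_nonneg_right h6 hD0))
    _ = _ := by ring

/-- One step of the decay of the increments `z(·,t+h) - z(·,t)`. -/
theorem increment_decay_step {ε B : ℝ} (hε : 0 < ε) (hεB : ε ≤ B) {N : ℕ}
    (hN : 4 * B + 1 < 2 * N * ε) :
    ∃ θ > 0, ∀ (z : ℝ → ℝ → ℝ) (h : ℝ), 0 < h →
      (∀ x t, 0 ≤ t → |z x t| ≤ B) → (∀ t, 0 ≤ t → Continuous fun x => z x t) →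
      (∀ s t x, 0 ≤ s → s ≤ t →
        (∫ η : ℝ, Real.exp (-η ^ 2 / 4)) * max (z x (t + h) - z x t) 0 ^ 3 ≤
          ∫ η, Real.exp (-η ^ 2 / 4) *
            max (z (x + Real.sqrt (t - s) * η) (s + h) - z (x + Real.sqrt (t - s) * η) s) 0 ^ 3) →
      ∀ t m, N * h ≤ t → ε ≤ m → m ≤ 2 * B →
        (∀ i : ℕ, 1 ≤ i → i ≤ N → ∀ x, z x (t - i * h + h) - z x (t - i * h) ≤ m) →
        ∀ x, z x (t + h) - z x t ≤ m - θ := by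
  set A := ∫ η : ℝ, Real.exp (-η ^ 2 / 4) with hA
  have hA0 : 0 < A := integral_exp_pos integrable_gaussian_quarter
  have hB : 0 < B := hε.trans_le hεB
  have hN0 : (0:ℝ) < N := by
    by_contra hneg
    have := mul_nonpos_of_nonpos_of_nonneg (not_lt.1 hneg) hε.le
    linarith
  set P := Real.sqrt N * Real.exp (1 / 4) * (12 * B ^ 2 * A) with hP
  have hP0 : 0 < P := by positivity
  set C1 := (ε + 4 * B) / ε ^ 3 with hC1
  have hC10 : 0 < C1 := by positivity
  refine ⟨min ε (1 / (N * C1 * P)), lt_min hε (by positivity), ?_⟩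
  intro z h hh hzB hzc havg t m ht hm hmB hy x
  set θ := min ε (1 / (N * C1 * P)) with hθ
  have hθ0 : 0 < θ := lt_min hε (by positivity)
  have hθε : θ ≤ ε := min_le_left _ _
  have hθP : N * C1 * P * θ ≤ 1 := by
    have := mul_le_mul_of_nonneg_left (min_le_right ε (1 / (N * C1 * P)))
      (show 0 ≤ N * C1 * P by positivity)
    rwa [mul_one_div_cancel (by positivity)] at this
  have hm0 : 0 < m := hε.trans_le hm
  by_contra hcon
  rw [not_le] at hcon
  have hti : ∀ i : ℕ, i ≤ N → 0 ≤ t - i * h := fun i hi => by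
    have : (i:ℝ) * h ≤ N * h := by gcongr
    linarith
  have key : ∀ i : ℕ, 1 ≤ i → i ≤ N →
      ∫ ζ in (-1:ℝ)..1, (m - (z (x + Real.sqrt h * ζ) (t - i * h + h) -
        z (x + Real.sqrt h * ζ) (t - i * h))) ≤ C1 * (P * θ) := by
    intro i hi hiN
    have h0 := hti i hiN
    have c1 := hzc _ h0
    have c2 := hzc (t - i * h + h) (by linarith)
    have ha := havg (t - i * h) t x h0 (by nlinarith [Nat.cast_nonneg (α := ℝ) i])
    rw [sub_sub_cancel] at ha
    set V : ℝ → ℝ := fun ξ => max (z ξ (t - i * h + h) - z ξ (t - i * h)) 0 ^ 3 with hV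
    have hVc : Continuous V := ((c2.sub c1).max continuous_const).pow 3
    have hVM : ∀ ξ, V ξ ≤ m ^ 3 := fun ξ =>
      pow_le_pow_left₀ (le_max_right _ _) (max_le (hy i hi hiN ξ) hm0.le) 3
    have hD : A * m ^ 3 - ∫ η, Real.exp (-η ^ 2 / 4) * V (x + Real.sqrt (i * h) * η) ≤
        12 * B ^ 2 * A * θ := by
      have h1 : (m - θ) ^ 3 ≤ max (z x (t + h) - z x t) 0 ^ 3 :=
        pow_le_pow_left₀ (by linarith) (hcon.le.trans (le_max_left _ _)) 3
      have h2 : m ^ 3 - (m - θ) ^ 3 ≤ 12 * B ^ 2 * θ := by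
        have e : m ^ 3 - (m - θ) ^ 3 ≤ 3 * m ^ 2 * θ := by
          have := mul_nonneg (sq_nonneg θ) (show 0 ≤ 3 * m - θ by linarith)
          linarith
        have : m ^ 2 ≤ (2 * B) ^ 2 := by gcongr
        have := mul_le_mul_of_nonneg_right this hθ0.le
        linarith
      have h3 := mul_le_mul_of_nonneg_left h1 hA0.le
      have h4 := mul_le_mul_of_nonneg_left h2 hA0.le
      linarith
    have h5 := integral_defect_le hVc (fun ξ => pow_nonneg (le_max_right _ _) 3) hVM hi hiN hD
    have h6 : ∫ ζ in (-1:ℝ)..1, (m - (z (x + Real.sqrt h * ζ) (t - i * h + h) -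
        z (x + Real.sqrt h * ζ) (t - i * h))) ≤
        ∫ ζ in (-1:ℝ)..1, C1 * (m ^ 3 - V (x + Real.sqrt h * ζ)) := by
      refine intervalIntegral.integral_mono_on (by norm_num)
        (Continuous.intervalIntegrable (by fun_prop) _ _)
        (Continuous.intervalIntegrable (by fun_prop) _ _) fun ζ _ => ?_
      have b1 := abs_le.1 (hzB (x + Real.sqrt h * ζ) _ h0)
      have b2 := abs_le.1 (hzB (x + Real.sqrt h * ζ) (t - i * h + h) (by linarith))
      exact sub_le_mul_cube_sub hε hm hmB (hy i hi hiN _) (by linarith [b1.2, b2.1])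
    rw [intervalIntegral.integral_const_mul] at h6
    refine h6.trans (mul_le_mul_of_nonneg_left (h5.trans_eq ?_) hC10.le)
    rw [hP]; ring
  have hsum : ∑ i ∈ Finset.range N,
      ∫ ζ in (-1:ℝ)..1, (m - (z (x + Real.sqrt h * ζ) (t - (i + 1 : ℕ) * h + h) -
        z (x + Real.sqrt h * ζ) (t - (i + 1 : ℕ) * h))) ≤ N * (C1 * (P * θ)) := by
    refine (Finset.sum_le_sum fun i hi => key (i + 1) (by omega)
      (by have := Finset.mem_range.1 hi; omega)).trans_eq ?_
    rw [Finset.sum_const, Finset.card_range, nsmul_eq_mul]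
  rw [← intervalIntegral.integral_finsetSum] at hsum
  · have htel : ∀ ξ, ∑ i ∈ Finset.range N, (m - (z ξ (t - (i + 1 : ℕ) * h + h) -
        z ξ (t - (i + 1 : ℕ) * h))) = N * m - (z ξ t - z ξ (t - N * h)) := by
      intro ξ
      rw [Finset.sum_sub_distrib, Finset.sum_const, Finset.card_range, nsmul_eq_mul]
      have := Finset.sum_range_sub' (fun i : ℕ => z ξ (t - i * h)) N
      simp only [Nat.cast_zero, zero_mul, sub_zero] at this
      rw [← this]
      congr 1
      refine Finset.sum_congr rfl fun i _ => ?_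
      congr 2
      push_cast; ring
    simp only [htel] at hsum
    have ct := hzc t (le_trans (by positivity) ht)
    have cN := hzc (t - N * h) (by linarith)
    have hlow : ∫ ζ in (-1:ℝ)..1, (N * m - 2 * B) ≤ ∫ ζ in (-1:ℝ)..1,
        (N * m - (z (x + Real.sqrt h * ζ) t - z (x + Real.sqrt h * ζ) (t - N * h))) := by
      refine intervalIntegral.integral_mono_on (by norm_num) (by simp)
        (Continuous.intervalIntegrable (by fun_prop) _ _) fun ζ _ => ?_
      have b1 := abs_le.1 (hzB (x + Real.sqrt h * ζ) t (le_trans (by positivity) ht))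
      have b2 := abs_le.1 (hzB (x + Real.sqrt h * ζ) (t - N * h) (by linarith))
      linarith [b1.2, b2.1]
    rw [intervalIntegral.integral_const, smul_eq_mul] at hlow
    have := mul_le_mul_of_nonneg_left hm hN0.le
    linarith
  · intro i hi
    have hi' := Finset.mem_range.1 hi
    have h0 := hti (i + 1) hi'
    have c1 := hzc _ h0
    have c2 := hzc (t - (i + 1 : ℕ) * h + h) (by linarith)
    exact Continuous.intervalIntegrable (by fun_prop) _ _

theorem increment_decay {ε B : ℝ} (hε : 0 < ε) (hεB : ε ≤ B) :
    ∃ n : ℕ, ∀ (z : ℝ → ℝ → ℝ) (h : ℝ), 0 < h →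
      (∀ x t, 0 ≤ t → |z x t| ≤ B) → (∀ t, 0 ≤ t → Continuous fun x => z x t) →
      (∀ s t x, 0 ≤ s → s ≤ t →
        (∫ η : ℝ, Real.exp (-η ^ 2 / 4)) * max (z x (t + h) - z x t) 0 ^ 3 ≤
          ∫ η, Real.exp (-η ^ 2 / 4) *
            max (z (x + Real.sqrt (t - s) * η) (s + h) - z (x + Real.sqrt (t - s) * η) s) 0 ^ 3) →
      ∀ t, n * h ≤ t → ∀ x, z x (t + h) - z x t ≤ ε := by
  obtain ⟨N, hN⟩ := exists_nat_gt ((4 * B + 1) / (2 * ε))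
  rw [div_lt_iff₀ (by positivity)] at hN
  obtain ⟨θ, hθ, step⟩ := increment_decay_step hε hεB (N := N) (by linarith)
  obtain ⟨k, hk⟩ := exists_nat_gt (2 * B / θ)
  rw [div_lt_iff₀ hθ] at hk
  refine ⟨k * N, fun z h hh hzB hzc havg => ?_⟩
  have claim : ∀ j : ℕ, ∀ t, j * N * h ≤ t → ∀ x, z x (t + h) - z x t ≤ max ε (2 * B - j * θ) := by
    intro j
    induction j with
    | zero =>
      intro t ht x
      simp only [Nat.cast_zero, zero_mul] at ht
      have b1 := abs_le.1 (hzB x t ht)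
      have b2 := abs_le.1 (hzB x (t + h) (by linarith))
      refine le_trans ?_ (le_max_right _ _)
      simp only [Nat.cast_zero, zero_mul]
      linarith [b1.1, b2.2]
    | succ j ih =>
      intro t ht x
      push_cast at ht ⊢
      have hj : (0:ℝ) ≤ j * N * h := by positivity
      have hjθ : (0:ℝ) ≤ j * θ := by positivity
      have := step z h hh hzB hzc havg t (max ε (2 * B - j * θ)) (by linarith) (le_max_left _ _)
        (max_le (by linarith) (by linarith)) (fun i _ hiN y => ih _ (by
          have : (i:ℝ) * h ≤ N * h := by gcongr
          linarith) y) x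
      rcases le_total ε (2 * B - j * θ) with h1 | h1
      · rw [max_eq_right h1] at this
        exact le_trans (by linarith) (le_max_right _ _)
      · rw [max_eq_left h1] at this
        exact le_trans (by linarith) (le_max_left _ _)
  intro t ht x
  have := claim k t (by push_cast at ht; exact ht) x
  rwa [max_eq_left (by linarith)] at this

theorem ascPochhammer_eval_succ_left (n : ℕ) (a : ℝ) :
    (ascPochhammer ℝ (n + 1)).eval a = a * (ascPochhammer ℝ n).eval (a + 1) := by
  rw [ascPochhammer_succ_left]
  simp

theorem ascPochhammer_ratio_nonneg {a b : ℝ} (ha : 0 < a) (hb : 0 < b) (n : ℕ) :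
    0 ≤ (ascPochhammer ℝ n).eval a / (ascPochhammer ℝ n).eval b :=
  div_nonneg (ascPochhammer_pos n a ha).le (ascPochhammer_pos n b hb).le

theorem ascPochhammer_ratio_le_one {a b : ℝ} (ha : 0 < a) (hab : a ≤ b) (n : ℕ) :
    (ascPochhammer ℝ n).eval a / (ascPochhammer ℝ n).eval b ≤ 1 := by
  rw [div_le_one (ascPochhammer_pos n b (ha.trans_le hab))]
  induction n with
  | zero => simp
  | succ n ih =>
    rw [ascPochhammer_succ_eval, ascPochhammer_succ_eval]
    exact mul_le_mul ih (by linarith) (by positivity)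
      (ascPochhammer_pos n b (ha.trans_le hab)).le

/-- A form of the Chu–Vandermonde identity. -/
theorem sum_choose_mul_ascPochhammer_ratio (n : ℕ) {a b : ℝ} (hb : 0 < b) :
    ∑ k ∈ Finset.range (n + 1), (n.choose k : ℝ) * (-1) ^ k *
      ((ascPochhammer ℝ k).eval a / (ascPochhammer ℝ k).eval b) =
      (ascPochhammer ℝ n).eval (b - a) / (ascPochhammer ℝ n).eval b := by
  induction n generalizing a b with
  | zero => simp
  | succ n ih =>
    have hrec : ∑ k ∈ Finset.range (n + 2), ((n + 1).choose k : ℝ) * (-1) ^ k *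
        ((ascPochhammer ℝ k).eval a / (ascPochhammer ℝ k).eval b) =
        ∑ k ∈ Finset.range (n + 1), (n.choose k : ℝ) * (-1) ^ k *
          ((ascPochhammer ℝ k).eval a / (ascPochhammer ℝ k).eval b) -
        a / b * ∑ k ∈ Finset.range (n + 1), (n.choose k : ℝ) * (-1) ^ k *
          ((ascPochhammer ℝ k).eval (a + 1) / (ascPochhammer ℝ k).eval (b + 1)) := by
      have hpad : ∑ k ∈ Finset.range (n + 1), (n.choose k : ℝ) * (-1) ^ k *
          ((ascPochhammer ℝ k).eval a / (ascPochhammer ℝ k).eval b) =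
          ∑ k ∈ Finset.range (n + 2), (n.choose k : ℝ) * (-1) ^ k *
          ((ascPochhammer ℝ k).eval a / (ascPochhammer ℝ k).eval b) := by
        rw [Finset.sum_range_succ _ (n + 1), Nat.choose_succ_self]
        simp
      rw [hpad, Finset.sum_range_succ' _ (n + 1), Finset.sum_range_succ' _ (n + 1),
        Finset.mul_sum, add_sub_right_comm, ← Finset.sum_sub_distrib]
      congr 1
      · refine Finset.sum_congr rfl fun k _ => ?_
        rw [Nat.choose_succ_succ', ascPochhammer_eval_succ_left, ascPochhammer_eval_succ_left,
          mul_div_mul_comm]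
        push_cast
        ring
      · simp
    rw [hrec, ih hb, ih (show 0 < b + 1 by linarith)]
    have h1 : b * (ascPochhammer ℝ n).eval (b + 1) = (ascPochhammer ℝ n).eval b * (b + n) := by
      rw [← ascPochhammer_eval_succ_left, ascPochhammer_succ_eval]
    have h2 : (ascPochhammer ℝ n).eval (b + 1) ≠ 0 :=
      (ascPochhammer_pos n (b + 1) (by linarith)).ne'
    have h3 : (ascPochhammer ℝ n).eval b ≠ 0 := (ascPochhammer_pos n b hb).ne'
    rw [show b + 1 - (a + 1) = b - a by ring, ascPochhammer_succ_eval, ascPochhammer_succ_eval,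
      div_mul_div_comm, h1]
    have h4 : b + n ≠ 0 := by positivity
    field_simp
    ring

theorem norm_kummer_term_le {a b : ℝ} (ha : 0 < a) (hab : a ≤ b) {z R : ℝ} (hz : |z| ≤ R)
    (n : ℕ) : ‖(ascPochhammer ℝ n).eval a / (ascPochhammer ℝ n).eval b * z ^ n /
      (n.factorial : ℝ)‖ ≤ R ^ n / n.factorial := by
  rw [norm_div, norm_mul, norm_pow, Real.norm_eq_abs, Real.norm_eq_abs, Real.norm_eq_abs,
    Nat.abs_cast, abs_of_nonneg (ascPochhammer_ratio_nonneg ha (ha.trans_le hab) n)]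
  have h1 := ascPochhammer_ratio_le_one ha hab n
  have h2 := ascPochhammer_ratio_nonneg ha (ha.trans_le hab) n
  have h3 : |z| ^ n ≤ R ^ n := pow_le_pow_left₀ (abs_nonneg z) hz n
  gcongr
  exact (mul_le_of_le_one_left (by positivity) h1).trans h3

theorem continuous_kummerM {a b : ℝ} (ha : 0 < a) (hab : a ≤ b) :
    Continuous fun z => kummerM a b z := by
  refine continuous_iff_continuousAt.2 fun z => ?_
  have h : ContinuousOn (fun z => kummerM a b z) {y | |y| ≤ |z| + 1} :=
    continuousOn_tsum (fun n => by fun_prop) (Real.summable_pow_div_factorial (|z| + 1))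
      fun n y hy => norm_kummer_term_le ha hab hy n
  refine h.continuousAt ?_
  filter_upwards [continuous_abs.continuousAt.eventually_lt_const
    (show |z| < |z| + 1 by linarith)] with y hy using hy.le

theorem kummerM_neg_pos {a b : ℝ} (ha : 0 < a) (hab : a < b) {x : ℝ} (hx : 0 ≤ x) :
    0 < kummerM a b (-x) := by
  have hs1 : Summable fun n : ℕ => ‖x ^ n / (n.factorial : ℝ)‖ :=
    (Real.summable_pow_div_factorial x).norm
  have hs2 : Summable fun n : ℕ => ‖(ascPochhammer ℝ n).eval a / (ascPochhammer ℝ n).eval b *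
      (-x) ^ n / (n.factorial : ℝ)‖ :=
    Summable.of_nonneg_of_le (fun n => norm_nonneg _)
      (fun n => norm_kummer_term_le ha hab.le (abs_neg x).le n)
      (Real.summable_pow_div_factorial |x|)
  have hterm : ∀ n : ℕ, ∑ kl ∈ Finset.HasAntidiagonal.antidiagonal n, x ^ kl.1 / (kl.1.factorial : ℝ) *
      ((ascPochhammer ℝ kl.2).eval a / (ascPochhammer ℝ kl.2).eval b * (-x) ^ kl.2 /
        (kl.2.factorial : ℝ)) = x ^ n / n.factorial *
      ((ascPochhammer ℝ n).eval (b - a) / (ascPochhammer ℝ n).eval b) := by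
    intro n
    rw [← sum_choose_mul_ascPochhammer_ratio n (a := a) (ha.trans hab), Finset.mul_sum,
      ← Finset.Nat.sum_antidiagonal_swap,
      Finset.Nat.sum_antidiagonal_eq_sum_range_succ_mk]
    refine Finset.sum_congr rfl fun k hk => ?_
    have hk' : k ≤ n := Nat.lt_succ_iff.1 (Finset.mem_range.1 hk)
    rw [Nat.cast_choose ℝ hk', neg_pow]
    simp only [Prod.swap]
    have e : x ^ n = x ^ (n - k) * x ^ k := by rw [← pow_add, Nat.sub_add_cancel hk']
    rw [e]
    have h1 : (n.factorial : ℝ) ≠ 0 := by positivity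
    have h2 : (k.factorial : ℝ) ≠ 0 := by positivity
    have h3 : ((n - k).factorial : ℝ) ≠ 0 := by positivity
    field_simp
  have hprod := tsum_mul_tsum_eq_tsum_sum_antidiagonal_of_summable_norm hs1 hs2
  have hsum := (summable_norm_sum_mul_antidiagonal_of_summable_norm hs1 hs2).of_norm
  simp only [hterm] at hprod hsum
  have hpos : 0 < ∑' n : ℕ, x ^ n / (n.factorial : ℝ) *
      ((ascPochhammer ℝ n).eval (b - a) / (ascPochhammer ℝ n).eval b) := by
    refine hsum.tsum_pos (fun n => ?_) 0 (by simp)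
    exact mul_nonneg (by positivity)
      (ascPochhammer_ratio_nonneg (sub_pos.2 hab) (ha.trans hab) n)
  rw [← hprod] at hpos
  exact pos_of_mul_pos_right hpos (tsum_nonneg fun n => by positivity)

theorem erfc_half (η : ℝ) : erfc (η / 2) = (Real.sqrt Real.pi)⁻¹ * gaussTail η := by
  have h := integral_comp_mul_left_Ioi (fun ζ : ℝ => Real.exp (-ζ ^ 2 / 4)) (η / 2) two_pos
  rw [mul_div_cancel₀ η two_ne_zero, smul_eq_mul] at h
  unfold erfc gaussTail
  rw [← mul_right_inj' (two_ne_zero (α := ℝ)), mul_inv_cancel_left₀ two_ne_zero] at h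
  rw [← h]
  have e : ∀ s : ℝ, -(2 * s) ^ 2 / 4 = -s ^ 2 := fun s => by ring
  simp only [e]
  ring

theorem one_le_kappaOf {γ : ℝ} (hγ : 0 ≤ γ) : 1 ≤ kappaOf γ := by
  have : 1 ≤ Real.sqrt (4 * γ + 1) := Real.one_le_sqrt.2 (by linarith)
  unfold kappaOf
  linarith

theorem continuous_Phi {α γ : ℝ} (hα : 0 < α) (hγ : 0 ≤ γ) (β : ℝ) :
    Continuous fun η => Phi α β γ η := by
  have hκ := one_le_kappaOf hγ
  have hM : 0 < kummerM (kappaOf γ / 2) (kappaOf γ + 1 / 2) (-α ^ 2 / 4) := by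
    rw [neg_div]
    exact kummerM_neg_pos (by linarith) (by linarith) (by positivity)
  have hMc := continuous_kummerM (a := kappaOf γ / 2) (b := kappaOf γ + 1 / 2) (by linarith)
    (by linarith)
  have hακ : 0 < α ^ kappaOf γ := Real.rpow_pos_of_pos hα _
  have he : erfc (α / 2) ≠ 0 := by
    rw [erfc_half]
    have := gaussTail_pos α
    positivity
  have hP : (fun η => Phi α β γ η) = fun η => if α ≤ η then
      ustarGamma α β γ * erfc (η / 2) / erfc (α / 2) else
      ustarGamma α β γ * η ^ kappaOf γ *
        kummerM (kappaOf γ / 2) (kappaOf γ + 1 / 2) (-η ^ 2 / 4) /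
        (α ^ kappaOf γ * kummerM (kappaOf γ / 2) (kappaOf γ + 1 / 2) (-α ^ 2 / 4)) := by
    funext η
    unfold Phi
    rcases lt_or_ge η α with h | h
    · rw [if_pos h, if_neg h.not_ge]
    · rw [if_neg h.not_gt, if_pos h]
  rw [hP]
  refine Continuous.if_le ?_ ?_ continuous_const continuous_id ?_
  · simp only [erfc_half]
    have := continuous_gaussTail
    fun_prop
  · have h1 : Continuous fun η : ℝ => η ^ kappaOf γ :=
      continuous_id.rpow_const fun _ => Or.inr (by linarith)
    have h2 : Continuous fun η : ℝ =>
        kummerM (kappaOf γ / 2) (kappaOf γ + 1 / 2) (-η ^ 2 / 4) :=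
      hMc.comp (by fun_prop : Continuous fun η : ℝ => -η ^ 2 / 4)
    exact ((continuous_const.mul h1).mul h2).div_const _
  · rintro η rfl
    rw [mul_div_assoc, div_self he, mul_assoc, mul_div_assoc,
      div_self (mul_pos hακ hM).ne']

theorem tendsto_Phi_atTop (α β γ : ℝ) : Tendsto (fun η => Phi α β γ η) atTop (nhds 0) := by
  have h : Tendsto (fun η => ustarGamma α β γ * erfc (η / 2) / erfc (α / 2)) atTop (nhds 0) := by
    simp only [erfc_half]
    simpa using (((tendsto_gaussTail_atTop.const_mul (Real.sqrt Real.pi)⁻¹).const_mul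
      (ustarGamma α β γ)).div_const ((Real.sqrt Real.pi)⁻¹ * gaussTail α))
  refine h.congr' ?_
  filter_upwards [eventually_ge_atTop α] with η hη
  exact (if_neg hη.not_gt).symm

theorem continuous_PsiP (α β : ℝ) : Continuous fun η => PsiP α β η := by
  simp only [PsiP_eq]
  have := continuous_gaussTail
  fun_prop

theorem tendsto_PsiP_atTop (α β : ℝ) : Tendsto (fun η => PsiP α β η) atTop (nhds 0) := by
  simp only [PsiP_eq]
  have h : Tendsto (fun η : ℝ => max η α) atTop atTop :=
    tendsto_atTop_mono (fun η => le_max_left η α) tendsto_id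
  simpa using (tendsto_gaussTail_atTop.comp h).const_mul (psiCoeff α β)

/-- A continuous function with a limit at infinity is almost invariant under dilations close to
the identity. -/
theorem exists_dilation_bound {f : ℝ → ℝ} (hf : Continuous f) {l : ℝ}
    (hl : Tendsto f atTop (nhds l)) {ε : ℝ} (hε : 0 < ε) :
    ∃ δ > 0, ∀ c η, 1 ≤ c → c ≤ 1 + δ → 0 ≤ η → |f (c * η) - f η| ≤ ε := by
  obtain ⟨R0, hR0⟩ := eventually_atTop.1 (hl.eventually (Metric.ball_mem_nhds l (half_pos hε)))
  set R := max R0 1 with hR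
  have hR1 : 1 ≤ R := le_max_right _ _
  have hRl : ∀ η, R ≤ η → |f η - l| < ε / 2 := fun η hη => hR0 η ((le_max_left _ _).trans hη)
  have hu := isCompact_Icc.uniformContinuousOn_of_continuous
    (hf.continuousOn (s := Icc 0 (2 * R)))
  rw [Metric.uniformContinuousOn_iff] at hu
  obtain ⟨δ', hδ', hu⟩ := hu ε hε
  refine ⟨min 1 (δ' / (2 * R)), lt_min one_pos (by positivity), fun c η hc1 hc hη => ?_⟩
  have hle : η ≤ c * η := le_mul_of_one_le_left hη hc1
  rcases le_total η R with h | h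
  · have hc2 : c ≤ 2 := hc.trans (by linarith [min_le_left 1 (δ' / (2 * R))])
    have h3 : (c - 1) * R < δ' := by
      have h4 : c - 1 ≤ δ' / (2 * R) := by linarith [min_le_right 1 (δ' / (2 * R))]
      have := mul_le_mul_of_nonneg_right h4 (show 0 ≤ R by linarith)
      have e : δ' / (2 * R) * R = δ' / 2 := by field_simp
      linarith
    have h5 : (c - 1) * η ≤ (c - 1) * R := mul_le_mul_of_nonneg_left h (by linarith)
    refine (hu (c * η) ⟨by positivity, ?_⟩ η ⟨hη, by linarith⟩ ?_).le
    · nlinarith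
    · rw [Real.dist_eq, abs_of_nonneg (by linarith)]
      linarith
  · have h1 := abs_lt.1 (hRl η h)
    have h2 := abs_lt.1 (hRl (c * η) (h.trans hle))
    rw [abs_le]
    constructor <;> linarith [h1.1, h1.2, h2.1, h2.2]

theorem exists_increment_bound {α β : ℝ} (hα : 0 < α) (hβ : 0 < β) {p u w : ℝ → ℝ → ℝ}
    (hadm : IsAdmissible p) (hnn : ∀ x t, 0 ≤ p x t)
    (hmono : ∀ x, MonotoneOn (fun t => p x t) (Ici (0:ℝ))) (heven : ∀ x t, u (-x) t = u x t)
    (hreg : AuxReg α β u w) (hweak : WeakForm α β u p w) {C : ℝ}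
    (hC : ∀ x t, 0 ≤ t → |u x t| ≤ C) {ε : ℝ} (hε : 0 < ε) :
    ∃ n : ℕ, ∀ h : ℝ, 0 < h → ∀ t : ℝ, n * h ≤ t → ∀ x,
      (u x (t + h) - psi α β x (t + h)) - (u x t - psi α β x t) ≤ ε := by
  have hC0 : 0 ≤ C := (abs_nonneg _).trans (hC 0 0 le_rfl)
  have hK0 : 0 ≤ psiCoeff α β * gaussTail α :=
    mul_nonneg (psiCoeff_pos hα hβ).le (gaussTail_nonneg α)
  obtain ⟨n, hn⟩ := increment_decay hε
    (show ε ≤ C + psiCoeff α β * gaussTail α + ε by linarith)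
  refine ⟨n, fun h hh => hn (fun x t => u x t - psi α β x t) h hh (fun x t ht => ?_)
    (fun t ht => continuous_slice hreg.2.1 ht) fun s t x hs hst => ?_⟩
  · have h1 := abs_le.1 (hC x t ht)
    have h2 := psi_nonneg hα hβ x t
    have h3 := psi_le hα hβ x t
    rw [abs_le]
    constructor <;> linarith [h1.1, h1.2]
  · exact (isHeatSubsolution_time_diff hα hβ hadm hnn hmono heven hreg hweak hC hh.le
      (show 0 < t + 1 by linarith)).le_average hs hst (by linarith) x

/-- In similarity coordinates the deviation from `Φ_γ` at a fixed point of space increases only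
slightly over time intervals that are short relative to the elapsed time. -/
theorem exists_deviation_increment_bound {α β : ℝ} (hα : 0 < α) (hβ : 0 < β)
    {p u w : ℝ → ℝ → ℝ} (hadm : IsAdmissible p) (hnn : ∀ x t, 0 ≤ p x t)
    (hmono : ∀ x, MonotoneOn (fun t => p x t) (Ici (0:ℝ))) (heven : ∀ x t, u (-x) t = u x t)
    (hreg : AuxReg α β u w) (hweak : WeakForm α β u p w) {C : ℝ}
    (hC : ∀ x t, 0 ≤ t → |u x t| ≤ C) {d γ : ℝ} (hd : 0 < d) (hγ : 0 ≤ γ) :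
    ∃ δ > 0, ∀ x r s, 0 ≤ x → 0 < r → r ≤ s → s ≤ (1 + δ) * r →
      (u x (s ^ 2) - Phi α β γ (x / s)) - (u x (r ^ 2) - Phi α β γ (x / r)) ≤ d / 2 := by
  have hε : 0 < d / 6 := by positivity
  obtain ⟨n, hn⟩ := exists_increment_bound hα hβ hadm hnn hmono heven hreg hweak hC hε
  obtain ⟨δ₁, hδ₁, hΦ⟩ := exists_dilation_bound (continuous_Phi hα hγ β)
    (tendsto_Phi_atTop α β γ) hε
  obtain ⟨δ₂, hδ₂, hΨ⟩ := exists_dilation_bound (continuous_PsiP α β)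
    (tendsto_PsiP_atTop α β) hε
  have hn1 : (0:ℝ) < 1 / (3 * n + 1) := by positivity
  refine ⟨min (1 / (3 * n + 1)) (min δ₁ δ₂), lt_min hn1 (lt_min hδ₁ hδ₂),
    fun x r s hx hr hrs hs => ?_⟩
  set δ := min (1 / (3 * n + 1 : ℝ)) (min δ₁ δ₂) with hδ
  have d0 : 0 < δ := lt_min hn1 (lt_min hδ₁ hδ₂)
  have d1 : δ ≤ δ₁ := (min_le_right _ _).trans (min_le_left _ _)
  have d2 : δ ≤ δ₂ := (min_le_right _ _).trans (min_le_right _ _)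
  have d3 : δ * (3 * n + 1) ≤ 1 := (le_div_iff₀ (by positivity)).1 (min_le_left _ _)
  have hs0 : 0 < s := hr.trans_le hrs
  rcases hrs.eq_or_lt with rfl | hlt
  · linarith
  have hc1 : 1 ≤ s / r := (one_le_div hr).2 hrs
  have hc : s / r ≤ 1 + δ := (div_le_iff₀ hr).2 hs
  have hη : 0 ≤ x / s := by positivity
  have e : s / r * (x / s) = x / r := by field_simp
  have h1 := hΦ (s / r) (x / s) hc1 (by linarith) hη
  have h2 := hΨ (s / r) (x / s) hc1 (by linarith) hη
  rw [e, abs_le] at h1 h2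
  have hp : ∀ τ, 0 < τ → psi α β x (τ ^ 2) = PsiP α β (x / τ) := fun τ hτ => by
    rw [psi_of_pos _ _ _ (by positivity), Real.sqrt_sq hτ.le, abs_of_nonneg hx, PsiP_eq]
  have h3 : (n:ℝ) * (s ^ 2 - r ^ 2) ≤ r ^ 2 := by
    have hn0 : (0:ℝ) ≤ n := Nat.cast_nonneg n
    have hδ1 : δ ≤ 1 := by
      have := mul_nonneg d0.le hn0
      linarith
    have a1 : s ^ 2 ≤ ((1 + δ) * r) ^ 2 := by gcongr
    have a2 : (n:ℝ) * (s ^ 2 - r ^ 2) ≤ n * ((2 * δ + δ ^ 2) * r ^ 2) := by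
      refine mul_le_mul_of_nonneg_left ?_ hn0
      linarith
    have a3 : (n:ℝ) * (2 * δ + δ ^ 2) ≤ 1 := by
      have : δ ^ 2 ≤ δ := by nlinarith
      have := mul_le_mul_of_nonneg_left this hn0
      linarith
    have a4 := mul_le_mul_of_nonneg_right a3 (sq_nonneg r)
    linarith
  have h4 := hn (s ^ 2 - r ^ 2) (by nlinarith) (r ^ 2) h3 x
  rw [add_sub_cancel, hp s hs0, hp r hr] at h4
  linarith [h1.1, h1.2, h2.1, h2.2]

/-- peak lemma: quantitative persistence of deviations from the
profile `Φ_γ` in similarity coordinates `v(η,s) = u(ηs, s²)`. -/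
theorem peak_lemma (α β : ℝ) (hα : 0 < α) (hβ : 0 < β)
    (p : ℝ → ℝ → ℝ) (hadm : IsAdmissible p)
    (hnn : ∀ x t : ℝ, 0 ≤ p x t)
    (hmono : ∀ x : ℝ, MonotoneOn (fun t => p x t) (Set.Ici (0:ℝ)))
    (u : ℝ → ℝ → ℝ) (hsol : IsAuxSolution α β p u)
    (hbdd : ∃ C : ℝ, ∀ x t : ℝ, 0 ≤ t → |u x t| ≤ C)
    (v : ℝ → ℝ → ℝ) (hv : ∀ η s : ℝ, v η s = u (η * s) (s ^ 2))
    (d γ : ℝ) (hd : 0 < d) (hγ : 0 ≤ γ) :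
    (∃ ω ∈ Set.Ioo (0:ℝ) 1, ∀ η s : ℝ, 0 ≤ η → 0 < s →
      d ≤ v η s - Phi α β γ η →
      ∀ s' ∈ Set.Icc (ω * s) s, ∃ η' : ℝ, 0 ≤ η' ∧ d / 2 ≤ v η' s' - Phi α β γ η') ∧
    (∃ ω : ℝ, 1 < ω ∧ ∀ η s : ℝ, 0 ≤ η → 0 < s →
      v η s - Phi α β γ η ≤ -d →
      ∀ s' ∈ Set.Icc s (ω * s), ∃ η' : ℝ, 0 ≤ η' ∧ v η' s' - Phi α β γ η' ≤ -(d / 2)) := by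
  obtain ⟨heven, w, hreg, hweak⟩ := hsol
  obtain ⟨C, hC⟩ := hbdd
  obtain ⟨δ, hδ, key⟩ := exists_deviation_increment_bound hα hβ hadm hnn hmono heven hreg hweak hC
    hd hγ
  have h1δ : 0 < 1 + δ := by linarith
  refine ⟨⟨1 / (1 + δ), ⟨by positivity, (div_lt_one h1δ).2 (by linarith)⟩, ?_⟩,
    1 + δ, by linarith, ?_⟩
  · intro η s hη hs hdev s' hs'
    have hs'0 : 0 < s' := lt_of_lt_of_le (by positivity) hs'.1
    have hle : s ≤ (1 + δ) * s' := by
      have := mul_le_mul_of_nonneg_left hs'.1 h1δ.le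
      rwa [← mul_assoc, mul_one_div_cancel h1δ.ne', one_mul] at this
    have h := key (η * s) s' s (by positivity) hs'0 hs'.2 hle
    rw [mul_div_cancel_right₀ η hs.ne'] at h
    refine ⟨η * s / s', by positivity, ?_⟩
    rw [hv] at hdev ⊢
    rw [div_mul_cancel₀ _ hs'0.ne']
    linarith
  · intro η s hη hs hdev s' hs'
    have hs'0 : 0 < s' := hs.trans_le hs'.1
    have h := key (η * s) s s' (by positivity) hs hs'.1 hs'.2
    rw [mul_div_cancel_right₀ η hs.ne'] at h
    refine ⟨η * s / s', by positivity, ?_⟩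
    rw [hv] at hdev ⊢
    rw [div_mul_cancel₀ _ hs'0.ne']
    linarith

end
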